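/- There exist invertible matrices R_λ ∈ ℂ^{SSYT(λ,p)×SSYT(λ,p)}, one for each partition λ of n into at most p parts, such that the map ψ : 𝒜 → ⊕_λ ℂ^{SSYT(λ,p)×SSYT(λ,p)} defined by ψ(M) := ⊕_λ R_λ^T (⟨M e_s, e_t⟩)_{s,t∈SSYT(λ,p)} R_λ is a bijective ℂ-algebra homomorphism satisfying ψ(M*) = ψ(M)* (conjugate transpose on each block). Moreover, without the matrices R_λ, the linear map ψ'(M) := ⊕_λ (⟨M e_s, e_t⟩)_{s,t∈SSYT(λ,p)} is a linear bijection from 𝒜 onto ⊕_λ ℂ^{SSYT(λ,p)×SSYT(λ,p)}, and M ∈ 𝒜 is positive semidefinite if and only if every block (⟨M e_s, e_t⟩)_{s,t∈SSYT(λ,p)} is positive semidefinite. -/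

import Mathlib

open scoped Classical
open Matrix
open scoped ComplexOrder

noncomputable section

/-- `D(a,b) ∈ ℕ^{p×p}`: `D(a,b)_{i,j}` counts positions `k` with `a_k = i` and `b_k = j`. -/
def Dmat {n p : ℕ} (a b : Fin n → Fin p) : Matrix (Fin p) (Fin p) ℕ :=
  Matrix.of fun i j => (Finset.univ.filter fun k => a k = i ∧ b k = j).card

/-- The 0/1 matrix `A_D` with `(A_D)_{a,b} = 1` iff `D(a,b) = D`. -/
def AD (n p : ℕ) (D : Matrix (Fin p) (Fin p) ℕ) :
    Matrix (Fin n → Fin p) (Fin n → Fin p) ℂ :=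
  Matrix.of fun a b => if Dmat a b = D then 1 else 0

/-- Row (0-indexed) of the `k`-th box (0-indexed, row-major numbering) of the Ferrers
diagram of `lam`: the number of indices `i` with `λ_0 + ⋯ + λ_i ≤ k`. -/
def rowOf (p : ℕ) (lam : Fin p → ℕ) (k : ℕ) : ℕ :=
  (Finset.univ.filter fun i : Fin p => (∑ j ∈ Finset.univ.filter (· ≤ i), lam j) ≤ k).card

/-- Column (0-indexed) of the `k`-th box of the Ferrers diagram of `lam`. -/
def colOf (p : ℕ) (lam : Fin p → ℕ) (k : ℕ) : ℕ :=
  k - ∑ j ∈ Finset.univ.filter (fun j : Fin p => (j : ℕ) < rowOf p lam k), lam j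

/-- The column group `C_λ`: permutations of the boxes mapping every box to a box
in the same column. -/
def colGroup (n p : ℕ) (lam : Fin p → ℕ) : Finset (Equiv.Perm (Fin n)) :=
  Finset.univ.filter fun σ => ∀ k : Fin n, colOf p lam (σ k : ℕ) = colOf p lam (k : ℕ)

/-- The row group `R_λ`: permutations of the boxes mapping every box to a box
in the same row. -/
def rowGroup (n p : ℕ) (lam : Fin p → ℕ) : Finset (Equiv.Perm (Fin n)) :=
  Finset.univ.filter fun σ => ∀ k : Fin n, rowOf p lam (σ k : ℕ) = rowOf p lam (k : ℕ)

/-- The vector `e_t = Σ_{σ ∈ C_λ} sgn(σ) Σ_{t' ∼ t} χ^{σ t'} ∈ ℂ^{[p]^n}`, where `t' ∼ t`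
means `t' = π t` for some `π ∈ R_λ`, and `(σ t)(k) = t(σ⁻¹ k)`. -/
noncomputable def eT (n p : ℕ) (lam : Fin p → ℕ) (t : Fin n → Fin p) :
    (Fin n → Fin p) → ℂ :=
  ∑ σ ∈ colGroup n p lam, ((Equiv.Perm.sign σ : ℤ) : ℂ) •
    ∑ t' ∈ Finset.univ.filter (fun t' : Fin n → Fin p =>
        ∃ π ∈ rowGroup n p lam, t' = fun k => t (π⁻¹ k)),
      (Pi.single (fun k => t' (σ⁻¹ k)) (1 : ℂ) : (Fin n → Fin p) → ℂ)

/-- The tableau `t_λ` whose entries in row `i` all equal `i`. -/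
def tLam (n p : ℕ) (hp : 0 < p) (lam : Fin p → ℕ) : Fin n → Fin p :=
  fun k => ⟨rowOf p lam (k : ℕ) % p, Nat.mod_lt _ hp⟩

/-- The vector `e_λ := e_{t_λ}`. -/
noncomputable def eLam (n p : ℕ) (hp : 0 < p) (lam : Fin p → ℕ) : (Fin n → Fin p) → ℂ :=
  eT n p lam (tLam n p hp lam)

/-- The algebra `𝒜` of `S_n`-invariant matrices. -/
def invAlg (n p : ℕ) : Submodule ℂ (Matrix (Fin n → Fin p) (Fin n → Fin p) ℂ) where
  carrier := {M | ∀ σ : Equiv.Perm (Fin n), ∀ a b : Fin n → Fin p,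
    M (fun i => a (σ⁻¹ i)) (fun i => b (σ⁻¹ i)) = M a b}
  add_mem' := by
    intro x y hx hy σ a b
    simp only [Matrix.add_apply, hx σ a b, hy σ a b]
  zero_mem' := by
    intro σ a b
    rfl
  smul_mem' := by
    intro c x hx σ a b
    simp only [Matrix.smul_apply, hx σ a b]

/-- A tableau (word) of shape `λ` is semistandard: entries weakly increase along each row
and strictly increase down each column. -/
def IsSemistandard (n p : ℕ) (lam : Fin p → ℕ) (t : Fin n → Fin p) : Prop :=
  (∀ k k' : Fin n, rowOf p lam (k : ℕ) = rowOf p lam (k' : ℕ) → (k : ℕ) ≤ (k' : ℕ) →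
    t k ≤ t k') ∧
  (∀ k k' : Fin n, colOf p lam (k : ℕ) = colOf p lam (k' : ℕ) →
    rowOf p lam (k : ℕ) < rowOf p lam (k' : ℕ) → t k < t k')

/-- The set `SSYT(λ,p)` of semistandard tableaux of shape `λ` with entries in `[p]`. -/
abbrev SSYT (n p : ℕ) (lam : Fin p → ℕ) : Type :=
  {t : Fin n → Fin p // IsSemistandard n p lam t}

/-- Partitions of `n` into at most `p` parts. -/
abbrev PartIdx (n p : ℕ) : Type :=
  {lam : Fin p → ℕ // (∀ i j : Fin p, i ≤ j → lam j ≤ lam i) ∧ ∑ i, lam i = n}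

/-- The standard inner product `⟨x,y⟩ = Σ_a x_a conj(y_a)` on `ℂ^{[p]^n}`. -/
noncomputable def sinner {n p : ℕ} (x y : (Fin n → Fin p) → ℂ) : ℂ :=
  ∑ a, x a * (starRingEnd ℂ) (y a)

/-- The block `(⟨M e_s, e_t⟩)_{s,t ∈ SSYT(λ,p)}` of a matrix `M`, for each partition `λ`
of `n` into at most `p` parts (the entry in row `s`, column `t` being `⟨M e_t, e_s⟩`). -/
noncomputable def blockMap (n p : ℕ) (M : Matrix (Fin n → Fin p) (Fin n → Fin p) ℂ) :
    (lam : PartIdx n p) → Matrix (SSYT n p lam.1) (SSYT n p lam.1) ℂ :=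
  fun lam => Matrix.of fun s t =>
    sinner (M.mulVec (eT n p lam.1 t.1)) (eT n p lam.1 s.1)

section GroupAlgebra

variable {G : Type*} [Group G]

/-- In a group algebra, the coefficient of the identity is a trace. -/
lemma MonoidAlgebra.coeff_mul_one_comm (x y : MonoidAlgebra ℂ G) :
    (x * y).coeff 1 = (y * x).coeff 1 := by
  induction x using MonoidAlgebra.induction_linear with
  | zero => simp
  | add a b ha hb => simp [add_mul, mul_add, ha, hb]
  | single g r =>
    rw [MonoidAlgebra.coeff_single_mul_apply, MonoidAlgebra.coeff_mul_single_apply]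
    simp [mul_comm]

/-- A normalised quasi-idempotent determines its compressions of group elements. -/
lemma MonoidAlgebra.mul_single_mul_eq {y : MonoidAlgebra ℂ G} (h1 : y.coeff 1 = 1)
    (hy : ∀ x, ∃ c : ℂ, y * x * y = c • y) (g : G) :
    y * MonoidAlgebra.single g 1 * y = (y * y).coeff g⁻¹ • y := by
  obtain ⟨c, hc⟩ := hy (MonoidAlgebra.single g 1)
  have h2 := congrArg (fun z => z.coeff 1) hc
  simp only [MonoidAlgebra.coeff_smul_apply, h1, smul_eq_mul, mul_one] at h2
  rw [hc, ← h2, mul_assoc, MonoidAlgebra.coeff_mul_one_comm, mul_assoc,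
    MonoidAlgebra.coeff_single_mul_apply]
  simp

lemma MonoidAlgebra.mul_self_eq {y : MonoidAlgebra ℂ G} (h1 : y.coeff 1 = 1)
    (hy : ∀ x, ∃ c : ℂ, y * x * y = c • y) :
    y * y = (y * y).coeff 1 • y := by
  have := MonoidAlgebra.mul_single_mul_eq h1 hy 1
  rwa [← MonoidAlgebra.one_def, mul_one, inv_one] at this

variable [Fintype G]

lemma MonoidAlgebra.eq_sum_coeff_smul (x : MonoidAlgebra ℂ G) :
    x = ∑ g, x.coeff g • MonoidAlgebra.single g (1 : ℂ) := by
  ext h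
  simp [MonoidAlgebra.coeff_sum]

/-- A normalised element of a group algebra is not square-zero if its compressions of the algebra
are one-dimensional. -/
lemma MonoidAlgebra.coeff_mul_self_ne_zero {y : MonoidAlgebra ℂ G} (h1 : y.coeff 1 = 1)
    (hy : ∀ x, ∃ c : ℂ, y * x * y = c • y) : (y * y).coeff 1 ≠ 0 := by
  intro h0
  have hsq : y * y = 0 := by rw [MonoidAlgebra.mul_self_eq h1 hy, h0, zero_smul]
  let b : Module.Basis G ℂ (MonoidAlgebra ℂ G) :=
    Module.Basis.ofRepr (MonoidAlgebra.coeffLinearEquiv ℂ)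
  have hn : IsNilpotent (LinearMap.mulLeft ℂ y) := by
    refine ⟨2, ?_⟩
    rw [LinearMap.pow_mulLeft, pow_two, hsq, LinearMap.mulLeft_zero_eq_zero]
  have ht := (LinearMap.isNilpotent_trace_of_isNilpotent hn).eq_zero
  rw [LinearMap.trace_eq_matrix_trace ℂ b, Matrix.trace] at ht
  have hd : ∀ g, (LinearMap.toMatrix b b (LinearMap.mulLeft ℂ y)).diag g = 1 := by
    intro g
    have hb : b g = MonoidAlgebra.single g 1 := rfl
    rw [Matrix.diag_apply, LinearMap.toMatrix_apply, hb, LinearMap.mulLeft_apply]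
    change (y * MonoidAlgebra.single g 1).coeff g = 1
    rw [MonoidAlgebra.coeff_mul_single_apply]
    simp [h1]
  rw [Finset.sum_congr rfl fun g _ => hd g] at ht
  simp at ht

/-- The sum of all conjugates of an element of a group algebra. -/
def conjSum (y : MonoidAlgebra ℂ G) : MonoidAlgebra ℂ G :=
  ∑ g : G, MonoidAlgebra.single g 1 * y * MonoidAlgebra.single g⁻¹ 1

lemma coeff_conjSum_conj (y : MonoidAlgebra ℂ G) (h k : G) :
    (conjSum y).coeff (h * k * h⁻¹) = (conjSum y).coeff k := by
  simp only [conjSum, MonoidAlgebra.coeff_sum, Finsupp.finsetSum_apply,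
    MonoidAlgebra.coeff_mul_single_apply, MonoidAlgebra.coeff_single_mul_apply]
  refine Fintype.sum_equiv (Equiv.mulLeft h⁻¹) _ _ fun g => ?_
  simp [mul_assoc]

lemma mul_conjSum_mul_eq {y : MonoidAlgebra ℂ G} (h1 : y.coeff 1 = 1)
    (hy : ∀ x, ∃ c : ℂ, y * x * y = c • y) :
    y * conjSum y * y = ((y * y).coeff 1) ^ 3 • y := by
  set κ := (y * y).coeff 1 with hκ
  have hyy : y * y = κ • y := MonoidAlgebra.mul_self_eq h1 hy
  have hs : ∑ g : G, (y * y).coeff g⁻¹ • MonoidAlgebra.single g⁻¹ (1 : ℂ) = y * y := by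
    exact (Equiv.sum_comp (Equiv.inv G) fun g =>
      (y * y).coeff g • MonoidAlgebra.single g (1 : ℂ)).trans
        (MonoidAlgebra.eq_sum_coeff_smul (y * y)).symm
  calc y * conjSum y * y
      = ∑ g : G, (y * MonoidAlgebra.single g 1 * y) * MonoidAlgebra.single g⁻¹ 1 * y := by
        simp only [conjSum, Finset.mul_sum, Finset.sum_mul, mul_assoc]
    _ = y * (∑ g : G, (y * y).coeff g⁻¹ • MonoidAlgebra.single g⁻¹ 1) * y := by
        simp only [MonoidAlgebra.mul_single_mul_eq h1 hy, Finset.mul_sum, Finset.sum_mul,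
          smul_mul_assoc, mul_smul_comm]
    _ = y * (y * y) * y := by rw [hs]
    _ = κ ^ 3 • y := by
        rw [hyy, mul_smul_comm, hyy, smul_smul, smul_mul_assoc, hyy, smul_smul]; ring_nf

/-- If the number of mutually orthogonal normalised quasi-idempotents is the number of values of
a map separating conjugacy classes, then their conjugates generate the unit ideal. -/
lemma one_mem_span_conjSum {Λ : Type*} [Fintype Λ] (cls : G → Λ)
    (hcls : ∀ g h, cls g = cls h → IsConj g h) (y : Λ → MonoidAlgebra ℂ G)
    (h1 : ∀ l, (y l).coeff 1 = 1) (hy : ∀ l x, ∃ c : ℂ, y l * x * y l = c • y l)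
    (horth : ∀ l m, l ≠ m → ∀ x, y l * x * y m = 0) :
    (1 : MonoidAlgebra ℂ G) ∈ Submodule.span ℂ (Set.range fun l => conjSum (y l)) := by
  let T : (Λ → ℂ) →ₗ[ℂ] MonoidAlgebra ℂ G :=
    { toFun := fun f => ∑ g, f (cls g) • MonoidAlgebra.single g 1
      map_add' := fun f f' => by simp only [Pi.add_apply, add_smul, Finset.sum_add_distrib]
      map_smul' := fun c f => by
        simp only [Pi.smul_apply, smul_assoc, Finset.smul_sum, RingHom.id_apply] }
  have hT : ∀ z : MonoidAlgebra ℂ G, (∀ h k, z.coeff (h * k * h⁻¹) = z.coeff k) →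
      ∃ f, T f = z := by
    intro z hz
    have hfac : Function.FactorsThrough z.coeff cls := by
      intro g h hgh
      obtain ⟨c, hc⟩ := isConj_iff.1 (hcls g h hgh)
      rw [← hc, hz]
    refine ⟨Function.extend cls z.coeff 0, ?_⟩
    conv_rhs => rw [MonoidAlgebra.eq_sum_coeff_smul z]
    exact Finset.sum_congr rfl fun g _ => by rw [hfac.extend_apply]
  choose f hf using fun l => hT (conjSum (y l)) (coeff_conjSum_conj (y l))
  have hzero : ∀ l m, l ≠ m → y l * conjSum (y m) * y l = 0 := by
    intro l m hlm
    simp only [conjSum, Finset.mul_sum, Finset.sum_mul]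
    refine Finset.sum_eq_zero fun g _ => ?_
    rw [← mul_assoc (y l), ← mul_assoc (y l), horth l m hlm, zero_mul, zero_mul]
  have hli : LinearIndependent ℂ f := by
    rw [Fintype.linearIndependent_iff]
    intro a ha l
    have h2 := congrArg (fun v => y l * T v * y l) ha
    simp only [map_sum, map_smul, hf, map_zero, mul_zero, zero_mul, Finset.mul_sum,
      Finset.sum_mul, mul_smul_comm, smul_mul_assoc] at h2
    rw [Finset.sum_eq_single l (fun m _ hm => by rw [hzero l m hm.symm, smul_zero])
      (fun h => absurd (Finset.mem_univ l) h), mul_conjSum_mul_eq (h1 l) (hy l)] at h2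
    have h3 := congrArg (fun v => v.coeff 1) h2
    have := MonoidAlgebra.coeff_mul_self_ne_zero (h1 l) (hy l)
    simpa [h1 l, this] using h3
  have hspan := hli.span_eq_top_of_card_eq_finrank' (by simp)
  obtain ⟨f1, hf1⟩ := hT 1 fun h k => by
    simp only [MonoidAlgebra.one_def, MonoidAlgebra.coeff_single, Finsupp.single_apply]
    congr 1
    exact propext ⟨fun h' => by
      have : h⁻¹ * (h * k * h⁻¹) * h = h⁻¹ * 1 * h := by rw [← h']
      simpa [mul_assoc, eq_comm] using this, fun h' => by rw [← h']; simp⟩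
  have h4 : T f1 ∈ (Submodule.span ℂ (Set.range f)).map T :=
    Submodule.mem_map_of_mem (hspan ▸ Submodule.mem_top)
  rw [hf1, Submodule.map_span, ← Set.range_comp] at h4
  convert h4 using 3
  exact funext fun l => (hf l).symm

end GroupAlgebra

section YoungSymmetrizer

open Equiv MonoidAlgebra

lemma exists_perm_of_card_fiber_eq {α β : Type*} [Fintype α] (f f' : α → β)
    (h : ∀ b, (Finset.univ.filter fun k => f k = b).card =
      (Finset.univ.filter fun k => f' k = b).card) :
    ∃ σ : Perm α, ∀ k, f' (σ k) = f k := by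
  have e : ∀ b, Nonempty ({k // f k = b} ≃ {k // f' k = b}) := fun b => by
    rw [← Fintype.card_eq, Fintype.card_subtype, Fintype.card_subtype]
    exact h b
  exact ⟨Equiv.ofFiberEquiv fun b => (e b).some, fun k => Equiv.ofFiberEquiv_map _ k⟩

variable {n : ℕ}

/-- The functions `row` and `col` are the coordinates of the boxes of a Ferrers diagram. -/
structure IsDiagram (row col : Fin n → ℕ) : Prop where
  inj : ∀ k k', row k = row k' → col k = col k' → k = k'
  lower : ∀ k i j, i ≤ row k → j ≤ col k → ∃ k', row k' = i ∧ col k' = j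

/-- The permutations preserving the fibres of a function. -/
def fiberPerms (f : Fin n → ℕ) : Finset (Perm (Fin n)) :=
  Finset.univ.filter fun σ => ∀ k, f (σ k) = f k

lemma mem_fiberPerms {f : Fin n → ℕ} {σ : Perm (Fin n)} :
    σ ∈ fiberPerms f ↔ ∀ k, f (σ k) = f k := by simp [fiberPerms]

lemma mul_mem_fiberPerms {f : Fin n → ℕ} {σ τ : Perm (Fin n)} (hσ : σ ∈ fiberPerms f)
    (hτ : τ ∈ fiberPerms f) : σ * τ ∈ fiberPerms f := by
  rw [mem_fiberPerms] at *
  intro k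
  rw [Perm.mul_apply, hσ, hτ]

lemma inv_mem_fiberPerms {f : Fin n → ℕ} {σ : Perm (Fin n)} (hσ : σ ∈ fiberPerms f) :
    σ⁻¹ ∈ fiberPerms f := by
  rw [mem_fiberPerms] at *
  intro k
  rw [← hσ]
  simp

lemma swap_mem_fiberPerms {f : Fin n → ℕ} {i j : Fin n} (h : f i = f j) :
    swap i j ∈ fiberPerms f := by
  rw [mem_fiberPerms]
  intro k
  rcases eq_or_ne k i with rfl | hi
  · simp [h]
  rcases eq_or_ne k j with rfl | hj
  · simp [h]
  rw [swap_apply_of_ne_of_ne hi hj]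

lemma sum_fiberPerms_mul_left {M : Type*} [AddCommMonoid M] {f : Fin n → ℕ} {τ : Perm (Fin n)}
    (hτ : τ ∈ fiberPerms f) (F : Perm (Fin n) → M) :
    ∑ σ ∈ fiberPerms f, F (τ * σ) = ∑ σ ∈ fiberPerms f, F σ :=
  Finset.sum_nbij' (fun σ => τ * σ) (fun σ => τ⁻¹ * σ)
    (fun _ h => mul_mem_fiberPerms hτ h)
    (fun _ h => mul_mem_fiberPerms (inv_mem_fiberPerms hτ) h)
    (by simp) (by simp) (by simp)

lemma sum_fiberPerms_mul_right {M : Type*} [AddCommMonoid M] {f : Fin n → ℕ}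
    {τ : Perm (Fin n)} (hτ : τ ∈ fiberPerms f) (F : Perm (Fin n) → M) :
    ∑ σ ∈ fiberPerms f, F (σ * τ) = ∑ σ ∈ fiberPerms f, F σ :=
  Finset.sum_nbij' (fun σ => σ * τ) (fun σ => σ * τ⁻¹)
    (fun _ h => mul_mem_fiberPerms h hτ)
    (fun _ h => mul_mem_fiberPerms h (inv_mem_fiberPerms hτ))
    (by simp) (by simp) (by simp)

/-- The row symmetrizer. -/
def rowSymm (row : Fin n → ℕ) : MonoidAlgebra ℂ (Perm (Fin n)) :=
  ∑ π ∈ fiberPerms row, single π 1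

/-- The column antisymmetrizer. -/
def colAnti (col : Fin n → ℕ) : MonoidAlgebra ℂ (Perm (Fin n)) :=
  ∑ σ ∈ fiberPerms col, single σ ((Perm.sign σ : ℤ) : ℂ)

/-- The Young symmetrizer. -/
def youngSymm (row col : Fin n → ℕ) : MonoidAlgebra ℂ (Perm (Fin n)) :=
  colAnti col * rowSymm row

lemma single_mul_rowSymm {row : Fin n → ℕ} {π : Perm (Fin n)} (hπ : π ∈ fiberPerms row) :
    single π 1 * rowSymm row = rowSymm row := by
  simp only [rowSymm, Finset.mul_sum, single_mul_single, mul_one]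
  exact sum_fiberPerms_mul_left hπ fun σ => single σ (1 : ℂ)

lemma rowSymm_mul_single {row : Fin n → ℕ} {π : Perm (Fin n)} (hπ : π ∈ fiberPerms row) :
    rowSymm row * single π 1 = rowSymm row := by
  simp only [rowSymm, Finset.sum_mul, single_mul_single, mul_one]
  exact sum_fiberPerms_mul_right hπ fun σ => single σ (1 : ℂ)

lemma sign_mul_self_complex (σ : Perm (Fin n)) :
    ((Perm.sign σ : ℤ) : ℂ) * ((Perm.sign σ : ℤ) : ℂ) = 1 := by
  rcases Int.units_eq_one_or (Perm.sign σ) with h | h <;> simp [h]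

lemma colAnti_mul_single {col : Fin n → ℕ} {σ : Perm (Fin n)} (hσ : σ ∈ fiberPerms col) :
    colAnti col * single σ 1 = ((Perm.sign σ : ℤ) : ℂ) • colAnti col := by
  simp only [colAnti, Finset.sum_mul, single_mul_single, mul_one, Finset.smul_sum, MonoidAlgebra.smul_single,
    smul_eq_mul]
  refine Eq.trans ?_ (sum_fiberPerms_mul_right hσ fun τ =>
    single τ (((Perm.sign σ : ℤ) : ℂ) * ((Perm.sign τ : ℤ) : ℂ)))
  refine Finset.sum_congr rfl fun τ _ => ?_
  rw [Perm.sign_mul, mul_comm (Perm.sign τ), Units.val_mul, Int.cast_mul, ← mul_assoc,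
    sign_mul_self_complex, one_mul]

lemma single_mul_colAnti {col : Fin n → ℕ} {σ : Perm (Fin n)} (hσ : σ ∈ fiberPerms col) :
    single σ 1 * colAnti col = ((Perm.sign σ : ℤ) : ℂ) • colAnti col := by
  simp only [colAnti, Finset.mul_sum, single_mul_single, one_mul, Finset.smul_sum, MonoidAlgebra.smul_single,
    smul_eq_mul]
  refine Eq.trans ?_ (sum_fiberPerms_mul_left hσ fun τ =>
    single τ (((Perm.sign σ : ℤ) : ℂ) * ((Perm.sign τ : ℤ) : ℂ)))
  refine Finset.sum_congr rfl fun τ _ => ?_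
  rw [Perm.sign_mul, Units.val_mul, Int.cast_mul, ← mul_assoc, sign_mul_self_complex, one_mul]

lemma eq_zero_of_eq_neg {M : Type*} [AddCommGroup M] [Module ℂ M] {x : M} (h : x = -x) :
    x = 0 := by
  have h2 : (2 : ℂ) • x = 0 := by
    rw [two_smul]
    nth_rewrite 1 [h]
    exact neg_add_cancel x
  exact (smul_eq_zero.1 h2).resolve_left two_ne_zero

lemma single_mul_swap_eq (g : Perm (Fin n)) (i j : Fin n) :
    (single g 1 * single (swap i j) 1 : MonoidAlgebra ℂ (Perm (Fin n))) =
      single (swap (g i) (g j)) 1 * single g 1 := by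
  rw [single_mul_single, single_mul_single, mul_swap_eq_swap_mul]

lemma colAnti_mul_single_mul_eq_zero {col : Fin n → ℕ} {g : Perm (Fin n)} {i j : Fin n}
    (hij : i ≠ j) (hc : col (g i) = col (g j)) {x : MonoidAlgebra ℂ (Perm (Fin n))}
    (hx : single (swap i j) 1 * x = x) : colAnti col * single g 1 * x = 0 := by
  have h : colAnti col * single g 1 * x = -(colAnti col * single g 1 * x) := by
    conv_lhs => rw [← hx, ← mul_assoc, mul_assoc (colAnti col), single_mul_swap_eq,
      ← mul_assoc (colAnti col), colAnti_mul_single (swap_mem_fiberPerms hc),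
      Perm.sign_swap (g.injective.ne hij)]
    simp
  exact eq_zero_of_eq_neg h

lemma rowSymm_mul_single_mul_colAnti_eq_zero {row col : Fin n → ℕ} {g : Perm (Fin n)}
    {i j : Fin n} (hij : i ≠ j) (hc : col i = col j) (hr : row (g i) = row (g j)) :
    rowSymm row * single g 1 * colAnti col = 0 := by
  have h1 : single (swap i j) 1 * colAnti col = -colAnti col := by
    rw [single_mul_colAnti (swap_mem_fiberPerms hc), Perm.sign_swap hij]
    simp
  have h : rowSymm row * single g 1 * colAnti col =
      -(rowSymm row * single g 1 * colAnti col) := by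
    conv_lhs => rw [← neg_neg (colAnti col), ← h1, mul_neg, ← mul_assoc,
      mul_assoc (rowSymm row), single_mul_swap_eq, ← mul_assoc (rowSymm row),
      rowSymm_mul_single (swap_mem_fiberPerms hr)]
  exact eq_zero_of_eq_neg h

/-- The number of boxes in the first `m` rows. -/
def boxesBelow (row : Fin n → ℕ) (m : ℕ) : ℕ := (Finset.univ.filter fun k => row k < m).card

lemma boxesBelow_eq_sum (row : Fin n → ℕ) (c : Fin n → ℕ) (N : ℕ) (hN : ∀ k, c k < N) (m : ℕ) :
    boxesBelow row m = ∑ j ∈ Finset.range N,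
      (Finset.univ.filter fun k => c k = j ∧ row k < m).card := by
  rw [boxesBelow, Finset.card_eq_sum_card_fiberwise (f := c) (t := Finset.range N)
    fun k _ => by simpa using hN k]
  refine Finset.sum_congr rfl fun j _ => ?_
  rw [Finset.filter_filter]
  simp only [and_comm]

lemma card_column_le {row col row' : Fin n → ℕ} (h : IsDiagram row col) {g : Perm (Fin n)}
    (hg : ∀ i j, i ≠ j → row' i = row' j → col (g i) ≠ col (g j)) (c m : ℕ) :
    (Finset.univ.filter fun k => col (g k) = c ∧ row' k < m).card ≤
      (Finset.univ.filter fun k => col k = c ∧ row k < m).card := by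
  by_cases hk : ∃ k, col k = c ∧ m ≤ row k
  · obtain ⟨k, hkc, hkm⟩ := hk
    have h1 : m ≤ (Finset.univ.filter fun k => col k = c ∧ row k < m).card := by
      have : Finset.range m ⊆
          (Finset.univ.filter fun k => col k = c ∧ row k < m).image row := by
        intro i hi
        rw [Finset.mem_range] at hi
        obtain ⟨k', h1, h2⟩ := h.lower k i c (by lia) hkc.ge
        exact Finset.mem_image.2 ⟨k', by simp [h1, h2, hi], h1⟩
      simpa using (Finset.card_le_card this).trans Finset.card_image_le
    refine le_trans ?_ h1
    rw [← Finset.card_range m]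
    refine Finset.card_le_card_of_injOn row' (fun k hk => by simp_all) ?_
    intro i hi j hj hij
    simp only [Finset.coe_filter, Finset.mem_univ, true_and, Set.mem_ofPred_eq] at hi hj
    by_contra hne
    exact hg i j hne hij (hi.1.trans hj.1.symm)
  · push Not at hk
    calc (Finset.univ.filter fun k => col (g k) = c ∧ row' k < m).card
        ≤ (Finset.univ.filter fun k => col k = c).card :=
          Finset.card_le_card_of_injOn g (fun k hk => by simp_all) g.injective.injOn
      _ ≤ _ := Finset.card_le_card fun k hkc => by
          simp only [Finset.mem_filter, Finset.mem_univ, true_and] at hkc ⊢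
          exact ⟨hkc, hk k hkc⟩

lemma exists_col_bound (col : Fin n → ℕ) : ∃ N, ∀ k, col k < N :=
  ⟨∑ k, col k + 1, fun k => Nat.lt_succ_of_le
    (Finset.single_le_sum (fun _ _ => Nat.zero_le _) (Finset.mem_univ k))⟩

lemma boxesBelow_le {row col row' : Fin n → ℕ} (h : IsDiagram row col) {g : Perm (Fin n)}
    (hg : ∀ i j, i ≠ j → row' i = row' j → col (g i) ≠ col (g j)) (m : ℕ) :
    boxesBelow row' m ≤ boxesBelow row m := by
  obtain ⟨N, hN⟩ := exists_col_bound col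
  rw [boxesBelow_eq_sum row' (fun k => col (g k)) N (fun k => hN _),
    boxesBelow_eq_sum row col N hN]
  exact Finset.sum_le_sum fun c _ => card_column_le h hg c m

lemma exists_eq_mul_of_forall_ne {row col : Fin n → ℕ} (h : IsDiagram row col)
    {g : Perm (Fin n)} (hg : ∀ i j, i ≠ j → row i = row j → col (g i) ≠ col (g j)) :
    ∃ σ ∈ fiberPerms col, ∃ π ∈ fiberPerms row, g = σ * π := by
  obtain ⟨N, hN⟩ := exists_col_bound col
  have heq : ∀ c m, (Finset.univ.filter fun k => col (g k) = c ∧ row k < m).card =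
      (Finset.univ.filter fun k => col k = c ∧ row k < m).card := by
    intro c m
    by_cases hc : c < N
    · refine (Finset.sum_eq_sum_iff_of_le fun c _ => card_column_le h hg c m).1 ?_ c
        (Finset.mem_range.2 hc)
      rw [← boxesBelow_eq_sum row (fun k => col (g k)) N (fun k => hN _),
        ← boxesBelow_eq_sum row col N hN]
    · have : ∀ k, col k ≠ c := fun k hk => hc (hk ▸ hN k)
      simp [this]
  have hsplit : ∀ (f : Fin n → ℕ) c i, (Finset.univ.filter fun k => f k = c ∧ row k < i + 1).card =
      (Finset.univ.filter fun k => f k = c ∧ row k < i).card +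
        (Finset.univ.filter fun k => (f k, row k) = (c, i)).card := by
    intro f c i
    rw [← Finset.card_union_of_disjoint]
    · congr 1
      ext k
      simp only [Finset.mem_filter, Finset.mem_univ, true_and, Finset.mem_union, Prod.mk.injEq]
      lia
    · rw [Finset.disjoint_filter]
      intro k _ h1 h2
      simp only [Prod.mk.injEq] at h2
      lia
  obtain ⟨π, hπ⟩ := exists_perm_of_card_fiber_eq (fun k => (col (g k), row k))
    (fun k => (col k, row k)) fun ⟨c, i⟩ => by
      have h1 := heq c (i + 1)
      rw [hsplit (fun k => col (g k)), hsplit col, heq c i] at h1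
      rw [Nat.add_left_cancel_iff] at h1
      convert h1
  simp only [Prod.mk.injEq] at hπ
  refine ⟨g * π⁻¹, mem_fiberPerms.2 fun k => ?_, π, mem_fiberPerms.2 fun k => (hπ k).2, by simp⟩
  rw [Perm.mul_apply, ← (hπ _).1]
  simp

lemma MonoidAlgebra.exists_single_of_mul_mul_ne_zero {G : Type*} [Group G]
    [Fintype G] {a b x : MonoidAlgebra ℂ G} (h : a * x * b ≠ 0) :
    ∃ g, a * single g 1 * b ≠ 0 := by
  by_contra! hc
  apply h
  rw [MonoidAlgebra.eq_sum_coeff_smul x]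
  simp only [Finset.mul_sum, Finset.sum_mul, mul_smul_comm, smul_mul_assoc, hc, smul_zero,
    Finset.sum_const_zero]

lemma colAnti_mul_mul_rowSymm_mem {row col : Fin n → ℕ} (h : IsDiagram row col)
    (x : MonoidAlgebra ℂ (Perm (Fin n))) :
    ∃ c : ℂ, colAnti col * x * rowSymm row = c • youngSymm row col := by
  rw [MonoidAlgebra.eq_sum_coeff_smul x]
  have : ∀ g, ∃ c : ℂ, colAnti col * single g 1 * rowSymm row = c • youngSymm row col := by
    intro g
    by_cases hg : ∀ i j, i ≠ j → row i = row j → col (g i) ≠ col (g j)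
    · obtain ⟨σ, hσ, π, hπ, rfl⟩ := exists_eq_mul_of_forall_ne h hg
      refine ⟨((Perm.sign σ : ℤ) : ℂ), ?_⟩
      rw [← mul_one (1 : ℂ), ← single_mul_single, ← mul_assoc, colAnti_mul_single hσ, mul_assoc,
        single_mul_rowSymm hπ, smul_mul_assoc, youngSymm]
    · push Not at hg
      obtain ⟨i, j, hij, hr, hc⟩ := hg
      exact ⟨0, by rw [colAnti_mul_single_mul_eq_zero hij hc
        (single_mul_rowSymm (swap_mem_fiberPerms hr)), zero_smul]⟩
  choose c hc using this
  refine ⟨∑ g, x.coeff g * c g, ?_⟩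
  simp only [Finset.mul_sum, Finset.sum_mul, mul_smul_comm, smul_mul_assoc, hc, smul_smul,
    Finset.sum_smul]

lemma youngSymm_mul_mul_youngSymm {row col : Fin n → ℕ} (h : IsDiagram row col)
    (x : MonoidAlgebra ℂ (Perm (Fin n))) :
    ∃ c : ℂ, youngSymm row col * x * youngSymm row col = c • youngSymm row col := by
  obtain ⟨c, hc⟩ := colAnti_mul_mul_rowSymm_mem h (rowSymm row * x * colAnti col)
  exact ⟨c, by rw [← hc]; simp only [youngSymm, mul_assoc]⟩

lemma youngSymm_mul_mul_youngSymm_of_ne {row col row' col' : Fin n → ℕ} (h : IsDiagram row col)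
    (h' : IsDiagram row' col') (hne : boxesBelow row ≠ boxesBelow row')
    (x : MonoidAlgebra ℂ (Perm (Fin n))) :
    youngSymm row col * x * youngSymm row' col' = 0 := by
  by_contra h0
  have h1 : colAnti col * (rowSymm row * x * colAnti col') * rowSymm row' ≠ 0 := by
    simpa only [youngSymm, mul_assoc] using h0
  have h2 : rowSymm row * x * colAnti col' ≠ 0 := fun h3 => h1 (by rw [h3, mul_zero, zero_mul])
  obtain ⟨g, hg⟩ := MonoidAlgebra.exists_single_of_mul_mul_ne_zero h1
  obtain ⟨g', hg'⟩ := MonoidAlgebra.exists_single_of_mul_mul_ne_zero h2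
  refine hne (funext fun m => le_antisymm ?_ ?_)
  · refine boxesBelow_le h' (g := g'⁻¹) (fun i j hij hr hc => hg' ?_) m
    exact rowSymm_mul_single_mul_colAnti_eq_zero (g'⁻¹.injective.ne hij) hc (by simpa using hr)
  · refine boxesBelow_le h (g := g) (fun i j hij hr hc => hg ?_) m
    exact colAnti_mul_single_mul_eq_zero hij hc (single_mul_rowSymm (swap_mem_fiberPerms hr))

lemma eq_one_of_mem_fiberPerms {row col : Fin n → ℕ} (h : IsDiagram row col) {σ : Perm (Fin n)}
    (hr : σ ∈ fiberPerms row) (hc : σ ∈ fiberPerms col) : σ = 1 :=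
  Equiv.ext fun k => h.inj _ _ (mem_fiberPerms.1 hr k) (mem_fiberPerms.1 hc k)

lemma coeff_one_youngSymm {row col : Fin n → ℕ} (h : IsDiagram row col) :
    (youngSymm row col).coeff 1 = 1 := by
  have h1 : ∀ f : Fin n → ℕ, (1 : Perm (Fin n)) ∈ fiberPerms f := fun f =>
    mem_fiberPerms.2 fun k => rfl
  simp only [youngSymm, colAnti, rowSymm, Finset.sum_mul, Finset.mul_sum, single_mul_single,
    mul_one, MonoidAlgebra.coeff_sum, Finsupp.finsetSum_apply, coeff_single]
  rw [Finset.sum_eq_single_of_mem 1 (h1 _), Finset.sum_eq_single_of_mem 1 (h1 _)]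
  · simp
  · intro π _ hπ
    simp [hπ]
  · intro σ hσ hne
    refine Finset.sum_eq_zero fun π hπ => Finsupp.single_eq_of_ne' fun h2 => hne ?_
    have h3 : σ = π⁻¹ := eq_inv_of_mul_eq_one_right h2
    exact eq_one_of_mem_fiberPerms h hσ (h3 ▸ inv_mem_fiberPerms hπ)

end YoungSymmetrizer

section Words

open Equiv

variable {n p : ℕ}

/-- The action of a permutation on words, as a matrix. -/
def permMat (p : ℕ) (g : Perm (Fin n)) : Matrix (Fin n → Fin p) (Fin n → Fin p) ℂ :=
  Matrix.of fun a b => if a ∘ g = b then 1 else 0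

lemma permMat_mul_apply (g : Perm (Fin n)) (M : Matrix (Fin n → Fin p) (Fin n → Fin p) ℂ)
    (a b : Fin n → Fin p) : (permMat p g * M) a b = M (a ∘ g) b := by
  simp [Matrix.mul_apply, permMat]

lemma comp_perm_eq_iff {α : Type*} (g : Perm (Fin n)) (a b : Fin n → α) :
    a ∘ g = b ↔ a = b ∘ ⇑g⁻¹ := by
  constructor
  · rintro rfl
    funext k
    simp
  · rintro rfl
    funext k
    simp

lemma mul_permMat_apply (g : Perm (Fin n)) (M : Matrix (Fin n → Fin p) (Fin n → Fin p) ℂ)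
    (a b : Fin n → Fin p) : (M * permMat p g) a b = M a (b ∘ ⇑g⁻¹) := by
  simp [Matrix.mul_apply, permMat, comp_perm_eq_iff]

/-- The action of permutations on words, as a homomorphism to matrices. -/
def permMatHom (n p : ℕ) : Perm (Fin n) →* Matrix (Fin n → Fin p) (Fin n → Fin p) ℂ where
  toFun := permMat p
  map_one' := by
    ext a b
    simp [permMat, Matrix.one_apply]
  map_mul' g h := by
    ext a b
    rw [permMat_mul_apply]
    rfl

/-- The action of the group algebra of the symmetric group on words. -/
def wordRep (n p : ℕ) :
    MonoidAlgebra ℂ (Perm (Fin n)) →ₐ[ℂ] Matrix (Fin n → Fin p) (Fin n → Fin p) ℂ :=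
  MonoidAlgebra.lift ℂ _ _ (permMatHom n p)

lemma wordRep_single (g : Perm (Fin n)) (c : ℂ) :
    wordRep n p (MonoidAlgebra.single g c) = c • permMat p g :=
  MonoidAlgebra.lift_single _ _ _

lemma wordRep_single_one (g : Perm (Fin n)) :
    wordRep n p (MonoidAlgebra.single g 1) = permMat p g := by
  rw [wordRep_single, one_smul]

lemma mem_invAlg_iff {M : Matrix (Fin n → Fin p) (Fin n → Fin p) ℂ} :
    M ∈ invAlg n p ↔ ∀ g, permMat p g * M = M * permMat p g := by
  change (∀ σ : Perm (Fin n), ∀ a b : Fin n → Fin p, M (a ∘ ⇑σ⁻¹) (b ∘ ⇑σ⁻¹) = M a b) ↔ _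
  constructor
  · intro h g
    ext a b
    rw [permMat_mul_apply, mul_permMat_apply, ← h g (a ∘ g) b]
    congr 1
    funext k
    simp
  · intro h g a b
    have := congrFun (congrFun (h g) (a ∘ ⇑g⁻¹)) b
    rw [permMat_mul_apply, mul_permMat_apply] at this
    rw [← this]
    congr 1
    funext k
    simp

lemma wordRep_mul_comm {M : Matrix (Fin n → Fin p) (Fin n → Fin p) ℂ} (hM : M ∈ invAlg n p)
    (x : MonoidAlgebra ℂ (Perm (Fin n))) : wordRep n p x * M = M * wordRep n p x := by
  rw [mem_invAlg_iff] at hM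
  rw [MonoidAlgebra.eq_sum_coeff_smul x]
  simp only [map_sum, map_smul, wordRep_single_one, Finset.sum_mul, Finset.mul_sum,
    smul_mul_assoc, mul_smul_comm, hM]

/-- The action of the Young symmetrizer on words. -/
def youngMat (p : ℕ) (row col : Fin n → ℕ) : Matrix (Fin n → Fin p) (Fin n → Fin p) ℂ :=
  wordRep n p (youngSymm row col)

lemma youngMat_apply (row col : Fin n → ℕ) (a t : Fin n → Fin p) :
    youngMat p row col a t = ∑ σ ∈ fiberPerms col, ∑ π ∈ fiberPerms row,
      if (a ∘ σ) ∘ π = t then ((Perm.sign σ : ℤ) : ℂ) else 0 := by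
  simp only [youngMat, youngSymm, colAnti, rowSymm, Finset.sum_mul, Finset.mul_sum,
    MonoidAlgebra.single_mul_single, mul_one, map_sum, wordRep_single, Matrix.sum_apply,
    Matrix.smul_apply, permMat, Matrix.of_apply, smul_eq_mul]
  rw [Finset.sum_comm]
  refine Finset.sum_congr rfl fun σ _ => Finset.sum_congr rfl fun π _ => ?_
  exact mul_boole _ _

lemma youngMat_comp {row col : Fin n → ℕ} {π : Perm (Fin n)} (hπ : π ∈ fiberPerms row)
    (a t : Fin n → Fin p) : youngMat p row col a (t ∘ π) = youngMat p row col a t := by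
  have h : youngMat p row col * permMat p π⁻¹ = youngMat p row col := by
    rw [youngMat, ← wordRep_single_one, ← map_mul, youngSymm, mul_assoc,
      rowSymm_mul_single (inv_mem_fiberPerms hπ)]
  conv_rhs => rw [← h, mul_permMat_apply, inv_inv]

lemma sum_youngMat_comp_eq_zero {row col f : Fin n → ℕ}
    (h : ∀ π ∈ fiberPerms row, ∃ x y, x ≠ y ∧ f x = f y ∧ col (π x) = col (π y))
    (a t : Fin n → Fin p) : ∑ τ ∈ fiberPerms f, youngMat p row col a (t ∘ τ) = 0 := by
  have h0 : youngSymm row col * rowSymm f = 0 := by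
    rw [youngSymm, rowSymm, Finset.mul_sum, Finset.sum_mul]
    refine Finset.sum_eq_zero fun π hπ => ?_
    obtain ⟨x, y, hxy, hf, hc⟩ := h π hπ
    exact colAnti_mul_single_mul_eq_zero hxy hc (single_mul_rowSymm (swap_mem_fiberPerms hf))
  have h1 := congrFun (congrFun (congrArg (wordRep n p) h0) a) t
  rw [map_mul, rowSymm, map_sum, Finset.mul_sum, Matrix.sum_apply, map_zero] at h1
  simp only [wordRep_single_one, mul_permMat_apply] at h1
  rw [← Finset.sum_nbij' (fun σ => σ⁻¹) (fun σ => σ⁻¹) (fun _ h => inv_mem_fiberPerms h)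
    (fun _ h => inv_mem_fiberPerms h) (by simp) (by simp) (fun _ _ => rfl)] at h1
  exact h1

/-- The weight `∑ row(k) t(k)` of a tableau. -/
def tabWeight (row : Fin n → ℕ) (t : Fin n → Fin p) : ℤ := ∑ k, (row k : ℤ) * (t k : ℕ)

lemma tabWeight_comp {row : Fin n → ℕ} {π : Perm (Fin n)} (hπ : π ∈ fiberPerms row)
    (t : Fin n → Fin p) : tabWeight row (t ∘ π) = tabWeight row t := by
  refine Eq.trans (Finset.sum_congr rfl fun k _ => ?_)
    (Equiv.sum_comp π fun k => (row k : ℤ) * (t k : ℕ))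
  rw [mem_fiberPerms.1 hπ, Function.comp_apply]

/-- The boxes of a diagram are numbered in row-major order. -/
structure IsRowMajor (row col : Fin n → ℕ) : Prop extends IsDiagram row col where
  mono : Monotone row
  col_lt : ∀ k k', row k = row k' → k < k' → col k < col k'

lemma IsRowMajor.le_of_col_le {row col : Fin n → ℕ} (h : IsRowMajor row col) {k k' : Fin n}
    (hr : row k = row k') (hc : col k ≤ col k') : k ≤ k' := by
  by_contra! hlt
  exact absurd (h.col_lt k' k hr.symm hlt) (by lia)

/-- The rows of a tableau are weakly increasing. -/
def RowSorted (row : Fin n → ℕ) (t : Fin n → Fin p) : Prop :=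
  ∀ k k', row k = row k' → k ≤ k' → t k ≤ t k'

/-- The columns of a tableau are strictly increasing. -/
def ColStrict (row col : Fin n → ℕ) (t : Fin n → Fin p) : Prop :=
  ∀ k k', col k = col k' → row k < row k' → t k < t k'

lemma RowSorted.monotone_lex {row : Fin n → ℕ} (hm : Monotone row) {t : Fin n → Fin p}
    (ht : RowSorted row t) : Monotone fun k => toLex (row k, t k) := by
  intro k k' hk
  rw [Prod.Lex.toLex_le_toLex]
  rcases (hm hk).lt_or_eq with h | h
  · exact Or.inl h
  · exact Or.inr ⟨h, ht k k' h hk⟩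

lemma exists_rowSorted {row : Fin n → ℕ} (hm : Monotone row) (t : Fin n → Fin p) :
    ∃ π ∈ fiberPerms row, RowSorted row (t ∘ π) := by
  set f : Fin n → ℕ ×ₗ Fin p := fun k => toLex (row k, t k) with hf
  have h1 : Monotone (f ∘ Tuple.sort f) := Tuple.monotone_sort f
  have h2 : Monotone (row ∘ Tuple.sort f) := fun k k' hk => Prod.Lex.monotone_fst _ _ (h1 hk)
  have h3 : row ∘ Tuple.sort f = row ∘ (1 : Perm (Fin n)) := Tuple.unique_monotone h2 hm
  refine ⟨Tuple.sort f, mem_fiberPerms.2 fun k => congrFun h3 k, fun k k' hr hk => ?_⟩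
  have h4 := h1 hk
  have h5 : row (Tuple.sort f k) = row (Tuple.sort f k') :=
    (congrFun h3 k).trans (hr.trans (congrFun h3 k').symm)
  rcases Prod.Lex.toLex_le_toLex.1 h4 with h | h
  · exact absurd h5 h.ne
  · exact h.2

lemma RowSorted.eq_of_comp {row : Fin n → ℕ} (hm : Monotone row) {s t : Fin n → Fin p}
    (hs : RowSorted row s) (ht : RowSorted row t) {π : Perm (Fin n)} (hπ : π ∈ fiberPerms row)
    (h : s ∘ π = t) : s = t := by
  have h1 : (fun k => toLex (row k, s k)) ∘ (1 : Perm (Fin n)) =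
      (fun k => toLex (row k, s k)) ∘ π := by
    refine Tuple.unique_monotone (hs.monotone_lex hm) ?_
    have h2 : (fun k => toLex (row k, s k)) ∘ π = fun k => toLex (row k, t k) := by
      funext k
      simp only [← h, mem_fiberPerms.1 hπ, Function.comp_apply]
    rw [h2]
    exact ht.monotone_lex hm
  rw [← h]
  funext k
  exact congrArg (fun z => (ofLex z).2) (congrFun h1 k)

lemma tabWeight_comp_lt {row col : Fin n → ℕ} (h : IsDiagram row col) {t : Fin n → Fin p}
    (ht : ColStrict row col t) {σ : Perm (Fin n)} (hσ : σ ∈ fiberPerms col) (hne : σ ≠ 1) :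
    tabWeight row (t ∘ σ) < tabWeight row t := by
  have hc := mem_fiberPerms.1 hσ
  obtain ⟨N, hN⟩ := exists_col_bound row
  set L : ℤ := ((N + p : ℕ) : ℤ) with hL
  set F : Fin n → ℤ := fun k => L * col k + row k with hF
  set T : Fin n → ℤ := fun k => L * col k + (t k : ℕ) with hT
  have hrow : ∀ k, (row k : ℤ) < L := fun k => by have := hN k; lia
  have htk : ∀ k, ((t k : ℕ) : ℤ) < L := fun k => by have := (t k).2; lia
  have hmul : ∀ i j, col i < col j → L * col i + L ≤ L * col j := fun i j hij => by
    have : L * (col i + 1) ≤ L * col j :=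
      mul_le_mul_of_nonneg_left (by exact_mod_cast hij) (by positivity)
    linarith
  have hmono : Monovary F T := by
    intro i j hij
    simp only [hF, hT] at hij ⊢
    rcases lt_trichotomy (col i) (col j) with h1 | h1 | h1
    · have := hmul i j h1
      have := hrow i
      lia
    · rw [h1] at hij ⊢
      have h2 : t i < t j := by
        have : ((t i : ℕ) : ℤ) < (t j : ℕ) := by linarith
        exact_mod_cast this
      by_contra! h3
      exact absurd (ht j i h1.symm (by lia)) h2.not_gt
    · have := hmul j i h1
      have := htk j
      lia
  have hexp : ∀ τ : Perm (Fin n), τ ∈ fiberPerms col → ∑ k, F k * T (τ k) =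
      ∑ k, (L * col k * (L * col k) + L * col k * (t k : ℕ) + row k * (L * col k)) +
        tabWeight row (t ∘ τ) := by
    intro τ hτ
    have hτ' := mem_fiberPerms.1 hτ
    have h1 : ∑ k, L * col k * ((t k : ℕ) : ℤ) = ∑ k, L * col k * ((t (τ k) : ℕ) : ℤ) := by
      rw [← Equiv.sum_comp τ]
      simp only [hτ']
    simp only [Finset.sum_add_distrib, h1, tabWeight]
    simp only [← Finset.sum_add_distrib]
    refine Finset.sum_congr rfl fun k _ => ?_
    simp only [hF, hT, hτ', Function.comp_apply]
    ring
  have hlt : ∑ k, F k * T (σ k) < ∑ k, F k * T k := by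
    rw [hmono.sum_mul_comp_perm_lt_sum_mul_iff]
    intro hv
    have hex : (Finset.univ.filter fun k => σ k ≠ k).Nonempty := by
      by_contra hemp
      rw [Finset.not_nonempty_iff_eq_empty, Finset.filter_eq_empty_iff] at hemp
      exact hne (Equiv.ext fun k => by simpa using hemp (Finset.mem_univ k))
    obtain ⟨k, hk, hmin⟩ := Finset.exists_min_image _ row hex
    simp only [Finset.mem_filter, Finset.mem_univ, true_and] at hk hmin
    have key : ∀ k', σ k' ≠ k' → k' ≠ k → col k' = col k → row k < row k' := fun k' h1 h2 h3 =>
      lt_of_le_of_ne (hmin k' h1) fun h4 => h2 (h.inj _ _ h4.symm h3)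
    have h1 : row k < row (σ k) := key _ (fun h' => hk (σ.injective h')) hk (hc k)
    have hk' : σ⁻¹ k ≠ k := fun h' => hk (by
      conv_lhs => rw [← h']
      simp)
    have hcol : col (σ⁻¹ k) = col k := by
      rw [← hc (σ⁻¹ k)]
      simp
    have h2 : row k < row (σ⁻¹ k) := key _ (by simpa using hk'.symm) hk' hcol
    have h3 : t k < t (σ k) := ht k (σ k) (hc k).symm h1
    have h4 := hv (i := σ⁻¹ k) (j := k) (by
      have : ((t k : ℕ) : ℤ) < (t (σ k) : ℕ) := by exact_mod_cast h3
      have h5 : σ (σ⁻¹ k) = k := by simp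
      simp only [hT, Function.comp_apply, h5, hc]
      linarith)
    simp only [hF, hcol] at h4
    lia
  have h1 := hexp 1 (mem_fiberPerms.2 fun _ => rfl)
  have h2 := hexp σ hσ
  simp only [Perm.coe_one, id_eq, Function.comp_id] at h1
  lia

lemma youngMat_ne_zero {row col : Fin n → ℕ} (h : IsRowMajor row col) {s t : Fin n → Fin p}
    (hs : RowSorted row s) (hs' : ColStrict row col s) (ht : RowSorted row t)
    (hne : youngMat p row col s t ≠ 0) : s = t ∨ tabWeight row t < tabWeight row s := by
  rw [youngMat_apply] at hne
  obtain ⟨σ, hσ, h1⟩ := Finset.exists_ne_zero_of_sum_ne_zero hne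
  obtain ⟨π, hπ, h2⟩ := Finset.exists_ne_zero_of_sum_ne_zero h1
  have h3 : (s ∘ σ) ∘ π = t := by
    by_contra h3
    exact h2 (if_neg h3)
  rcases eq_or_ne σ 1 with rfl | hne
  · exact Or.inl (hs.eq_of_comp h.mono ht hπ h3)
  · right
    rw [← h3, tabWeight_comp hπ]
    exact tabWeight_comp_lt h.toIsDiagram hs' hσ hne

lemma youngMat_self_ne_zero {row col : Fin n → ℕ} (h : IsRowMajor row col) {t : Fin n → Fin p}
    (ht' : ColStrict row col t) : youngMat p row col t t ≠ 0 := by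
  have h1 : ∀ f : Fin n → ℕ, (1 : Perm (Fin n)) ∈ fiberPerms f := fun f =>
    mem_fiberPerms.2 fun k => rfl
  rw [youngMat_apply, Finset.sum_eq_single_of_mem 1 (h1 _)]
  · rw [← Finset.sum_filter]
    simp only [Perm.sign_one, Units.val_one, Int.cast_one, Finset.sum_const, nsmul_eq_mul,
      mul_one, Nat.cast_ne_zero]
    exact (Finset.card_pos.2 ⟨1, Finset.mem_filter.2 ⟨h1 row, by simp⟩⟩).ne'
  · intro σ hσ hne
    refine Finset.sum_eq_zero fun π hπ => if_neg fun h3 => ?_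
    have := tabWeight_comp_lt h.toIsDiagram ht' hσ hne
    rw [← tabWeight_comp hπ, h3] at this
    exact this.ne rfl

lemma linearIndependent_youngMat {row col : Fin n → ℕ} (h : IsRowMajor row col) :
    LinearIndependent ℂ fun t : {t : Fin n → Fin p // RowSorted row t ∧ ColStrict row col t} =>
      fun a => youngMat p row col a t.1 := by
  rw [Fintype.linearIndependent_iff]
  by_contra! hc
  obtain ⟨c, hc, i, hi⟩ := hc
  obtain ⟨s, hs, hmin⟩ := Finset.exists_min_image (Finset.univ.filter fun t => c t ≠ 0)
    (fun t => tabWeight row t.1) ⟨i, by simpa using hi⟩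
  simp only [Finset.mem_filter, Finset.mem_univ, true_and] at hs hmin
  have h1 := congrFun hc s.1
  simp only [Finset.sum_apply, Pi.smul_apply, smul_eq_mul, Pi.zero_apply] at h1
  rw [Finset.sum_eq_single s] at h1
  · exact (mul_ne_zero hs (youngMat_self_ne_zero h s.2.2)) h1
  · intro t _ hts
    by_contra hne
    rcases youngMat_ne_zero h s.2.1 s.2.2 t.2.1 (right_ne_zero_of_mul hne) with h2 | h2
    · exact hts (Subtype.ext h2.symm)
    · exact absurd (hmin t (left_ne_zero_of_mul hne)) h2.not_ge
  · simp

end Words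

section Straightening

open Equiv

variable {n p : ℕ}

lemma exists_mem_fiberPerms_comp_eq {row : Fin n → ℕ} {t : Fin n → Fin p} {ρ : Perm (Fin n)}
    {m : Fin p} (h : ∀ k, row k = row (ρ k) ∨ t (ρ k) = m) :
    ∃ π ∈ fiberPerms row, t ∘ ρ = t ∘ π := by
  have hcard : ∀ (r : ℕ) (P : Fin p → Prop), ¬ P m →
      (Finset.univ.filter fun k => row k = r ∧ P (t (ρ k))).card =
        (Finset.univ.filter fun k => row k = r ∧ P (t k)).card := by
    intro r P hP
    refine Finset.card_equiv ρ fun k => ?_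
    simp only [Finset.mem_filter, Finset.mem_univ, true_and]
    refine and_congr_left fun hk => ?_
    rcases h k with h | h
    · rw [h]
    · exact absurd (h ▸ hk) hP
  have hadd : ∀ (r : ℕ) (u : Fin n → Fin p),
      (Finset.univ.filter fun k => row k = r ∧ u k = m).card +
        (Finset.univ.filter fun k => row k = r ∧ u k ≠ m).card =
        (Finset.univ.filter fun k => row k = r).card := by
    intro r u
    rw [← Finset.filter_filter, ← Finset.filter_filter]
    exact Finset.card_filter_add_card_filter_not _
  obtain ⟨π, hπ⟩ := exists_perm_of_card_fiber_eq (fun k => (row k, t (ρ k)))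
    (fun k => (row k, t k)) (by
      rintro ⟨r, v⟩
      simp only [Prod.mk.injEq]
      rcases eq_or_ne v m with rfl | hv
      · have h1 := hadd r t
        have h2 := hadd r (t ∘ ρ)
        have h3 := hcard r (fun z => z ≠ v) (by simp)
        simp only [Function.comp_apply] at h2
        lia
      · convert hcard r (fun z => z = v) hv.symm)
  refine ⟨π, mem_fiberPerms.2 fun k => congrArg Prod.fst (hπ k), ?_⟩
  funext k
  exact (congrArg Prod.snd (hπ k)).symm

lemma exists_garnir {row col : Fin n → ℕ} (h : IsRowMajor row col) {t : Fin n → Fin p}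
    (ht : RowSorted row t) (ht' : ¬ ColStrict row col t) :
    ∃ f : Fin n → ℕ,
      (∀ π ∈ fiberPerms row, ∃ x y, x ≠ y ∧ f x = f y ∧ col (π x) = col (π y)) ∧
      ∀ ρ ∈ fiberPerms f, tabWeight row t < tabWeight row (t ∘ ρ) ∨
        ∃ π ∈ fiberPerms row, t ∘ ρ = t ∘ π := by
  simp only [ColStrict, not_forall, not_lt] at ht'
  obtain ⟨k₀, k₁, hcol, hrow, hle⟩ := ht'
  set A : Finset (Fin n) := Finset.univ.filter fun k => row k = row k₀ ∧ k₀ ≤ k with hA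
  set B : Finset (Fin n) := Finset.univ.filter fun k => row k = row k₁ ∧ k ≤ k₁ with hB
  have memA : ∀ k, k ∈ A ↔ row k = row k₀ ∧ k₀ ≤ k := by simp [hA]
  have memB : ∀ k, k ∈ B ↔ row k = row k₁ ∧ k ≤ k₁ := by simp [hB]
  have hf : ∀ x y : Fin n, (if x ∈ A ∪ B then 0 else (x : ℕ) + 1) =
      (if y ∈ A ∪ B then 0 else (y : ℕ) + 1) → x = y ∨ (x ∈ A ∪ B ∧ y ∈ A ∪ B) := by
    intro x y hxy
    by_cases hx : x ∈ A ∪ B <;> by_cases hy : y ∈ A ∪ B <;>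
      simp only [hx, hy, if_true, if_false] at hxy ⊢
    · simp
    · lia
    · lia
    · left
      exact Fin.ext (by lia)
  refine ⟨fun k => if k ∈ A ∪ B then 0 else (k : ℕ) + 1, fun π hπ => ?_, fun ρ hρ => ?_⟩
  · have hπ' := mem_fiberPerms.1 hπ
    have hdisj : Disjoint A B := by
      rw [Finset.disjoint_left]
      intro k h1 h2
      rw [memA] at h1
      rw [memB] at h2
      lia
    set C : Finset (Fin n) := Finset.univ.filter fun k => row k = row k₀ with hC
    have h1 : C.card ≤ A.card + col k₀ := by
      have : (C.filter fun k => ¬ k₀ ≤ k).card ≤ (Finset.range (col k₀)).card := by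
        refine Finset.card_le_card_of_injOn col ?_ ?_
        · intro k hk
          simp only [hC, Finset.coe_filter, Finset.mem_filter, Finset.mem_univ, true_and,
            not_le, Set.mem_ofPred_eq] at hk
          simpa using h.col_lt k k₀ hk.1 hk.2
        · intro k hk k' hk' hkk
          simp only [hC, Finset.coe_filter, Finset.mem_filter, Finset.mem_univ, true_and,
            not_le, Set.mem_ofPred_eq] at hk hk'
          exact h.inj k k' (hk.1.trans hk'.1.symm) hkk
      rw [Finset.card_range] at this
      rw [← Finset.card_filter_add_card_filter_not (s := C) fun k => k₀ ≤ k, hC,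
        Finset.filter_filter, ← hA]
      lia
    have h2 : col k₁ + 1 ≤ B.card := by
      have : Finset.range (col k₁ + 1) ⊆ B.image col := by
        intro j hj
        rw [Finset.mem_range] at hj
        obtain ⟨k, hk, hk'⟩ := h.lower k₁ (row k₁) j le_rfl (by lia)
        exact Finset.mem_image.2 ⟨k, (memB k).2 ⟨hk, h.le_of_col_le hk (by lia)⟩, hk'⟩
      simpa using (Finset.card_le_card this).trans Finset.card_image_le
    have h3 : (C.image col).card < (A ∪ B).card := by
      rw [Finset.card_union_of_disjoint hdisj]
      have := Finset.card_image_le (s := C) (f := col)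
      lia
    have h4 : ∀ x ∈ A ∪ B, col (π x) ∈ C.image col := by
      intro x hx
      have : row k₀ ≤ row (π x) := by
        rw [hπ']
        rcases Finset.mem_union.1 hx with hx | hx
        · rw [((memA x).1 hx).1]
        · rw [((memB x).1 hx).1]
          exact hrow.le
      obtain ⟨k, hk, hk'⟩ := h.lower (π x) (row k₀) (col (π x)) this le_rfl
      exact Finset.mem_image.2 ⟨k, by simpa [hC] using hk, hk'⟩
    obtain ⟨x, hx, y, hy, hxy, hc⟩ := Finset.exists_ne_map_eq_of_card_lt_of_maps_to h3 h4
    exact ⟨x, y, hxy, by simp only [hx, hy, if_true], hc⟩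
  · have hρ' := fun k => hf _ _ (mem_fiberPerms.1 hρ k)
    have hterm : ∀ k, 0 ≤ ((row k : ℤ) - row (ρ k)) * ((t (ρ k) : ℕ) - (t k₀ : ℕ)) := by
      intro k
      rcases hρ' k with h1 | ⟨h1, h2⟩
      · simp [h1]
      have h3 : row k = row k₀ ∨ row k = row k₁ := by
        rcases Finset.mem_union.1 h2 with hx | hx
        · exact Or.inl ((memA k).1 hx).1
        · exact Or.inr ((memB k).1 hx).1
      rcases Finset.mem_union.1 h1 with hx | hx
      · rw [memA] at hx
        have h4 : t k₀ ≤ t (ρ k) := ht _ _ hx.1.symm hx.2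
        have h5 : (t k₀ : ℕ) ≤ t (ρ k) := h4
        exact mul_nonneg (by lia) (sub_nonneg.2 (by exact_mod_cast h5))
      · rw [memB] at hx
        have h4 : t (ρ k) ≤ t k₀ := (ht _ _ hx.1 hx.2).trans hle
        have h5 : (t (ρ k) : ℕ) ≤ t k₀ := h4
        exact mul_nonneg_of_nonpos_of_nonpos (by lia) (sub_nonpos.2 (by exact_mod_cast h5))
    have hsum : tabWeight row (t ∘ ρ) - tabWeight row t =
        ∑ k, ((row k : ℤ) - row (ρ k)) * ((t (ρ k) : ℕ) - (t k₀ : ℕ)) := by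
      have h1 : ∑ k, (row (ρ k) : ℤ) * (t (ρ k) : ℕ) = tabWeight row t :=
        Equiv.sum_comp ρ fun k => (row k : ℤ) * (t k : ℕ)
      have h2 : ∑ k, (row (ρ k) : ℤ) = ∑ k, (row k : ℤ) := Equiv.sum_comp ρ fun k => (row k : ℤ)
      simp only [sub_mul, mul_sub, Finset.sum_sub_distrib, ← Finset.sum_mul, h1, h2, tabWeight,
        Function.comp_apply]
      ring
    rcases (Finset.sum_nonneg fun k _ => hterm k).lt_or_eq with hlt | heq
    · left
      rw [← hsum] at hlt
      linarith
    · right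
      have h0 := (Finset.sum_eq_zero_iff_of_nonneg fun k _ => hterm k).1 heq.symm
      refine exists_mem_fiberPerms_comp_eq (m := t k₀) fun k => ?_
      rcases mul_eq_zero.1 (h0 k (Finset.mem_univ k)) with h1 | h1
      · left
        exact_mod_cast sub_eq_zero.1 h1
      · right
        exact Fin.ext (by exact_mod_cast sub_eq_zero.1 h1)

lemma tabWeight_le (row : Fin n → ℕ) (t : Fin n → Fin p) :
    tabWeight row t ≤ ∑ k, (row k : ℤ) * p :=
  Finset.sum_le_sum fun k _ =>
    mul_le_mul_of_nonneg_left (by exact_mod_cast (t k).2.le) (by positivity)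

lemma youngMat_mem_span {row col : Fin n → ℕ} (h : IsRowMajor row col) (t : Fin n → Fin p) :
    (fun a => youngMat p row col a t) ∈ Submodule.span ℂ (Set.range
      fun t : {t : Fin n → Fin p // RowSorted row t ∧ ColStrict row col t} =>
        fun a => youngMat p row col a t.1) := by
  set S := Submodule.span ℂ (Set.range
      fun t : {t : Fin n → Fin p // RowSorted row t ∧ ColStrict row col t} =>
        fun a => youngMat p row col a t.1) with hS
  induction hN : ((∑ k, (row k : ℤ) * p) - tabWeight row t).toNat
    using Nat.strong_induction_on generalizing t with
  | _ N ih =>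
    obtain ⟨π, hπ, hsort⟩ := exists_rowSorted h.mono t
    have hY : (fun a => youngMat p row col a t) = fun a => youngMat p row col a (t ∘ π) :=
      funext fun a => (youngMat_comp hπ a t).symm
    rw [← tabWeight_comp hπ t] at hN
    rw [hY]
    generalize t ∘ π = t' at hN hsort
    by_cases hcs : ColStrict row col t'
    · exact Submodule.subset_span ⟨⟨t', hsort, hcs⟩, rfl⟩
    obtain ⟨f, hf, hρ⟩ := exists_garnir h hsort hcs
    have h0 : ∑ ρ ∈ fiberPerms f, (fun a => youngMat p row col a (t' ∘ ρ)) = 0 := by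
      funext a
      rw [Finset.sum_apply]
      exact sum_youngMat_comp_eq_zero hf a t'
    rw [← Finset.sum_filter_add_sum_filter_not _
      (fun ρ : Perm (Fin n) => ∃ π ∈ fiberPerms row, t' ∘ ρ = t' ∘ π)] at h0
    have h1 : ∀ ρ ∈ (fiberPerms f).filter
        (fun ρ : Perm (Fin n) => ∃ π ∈ fiberPerms row, t' ∘ ρ = t' ∘ π),
        (fun a => youngMat p row col a (t' ∘ ρ)) = fun a => youngMat p row col a t' := by
      intro ρ hmem
      obtain ⟨π, hπ, heq⟩ := (Finset.mem_filter.1 hmem).2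
      funext a
      rw [heq, youngMat_comp hπ]
    rw [Finset.sum_congr rfl h1, Finset.sum_const, ← Nat.cast_smul_eq_nsmul ℂ] at h0
    have hpos : (((fiberPerms f).filter (fun ρ : Perm (Fin n) =>
        ∃ π ∈ fiberPerms row, t' ∘ ρ = t' ∘ π)).card : ℂ) ≠ 0 := by
      rw [Nat.cast_ne_zero]
      exact (Finset.card_pos.2 ⟨1, Finset.mem_filter.2 ⟨mem_fiberPerms.2 fun _ => rfl,
        1, mem_fiberPerms.2 fun _ => rfl, rfl⟩⟩).ne'
    rw [← Submodule.smul_mem_iff S hpos, eq_neg_of_add_eq_zero_left h0]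
    refine S.neg_mem (S.sum_mem fun ρ hmem => ?_)
    rw [Finset.mem_filter] at hmem
    have hlt := (hρ ρ hmem.1).resolve_right hmem.2
    have := tabWeight_le row (t' ∘ ρ)
    exact ih _ (by lia) (t' ∘ ρ) rfl

lemma youngMat_eq_zero {row col : Fin n → ℕ} (h : IsDiagram row col) {k : Fin n}
    (hk : p ≤ row k) : youngMat p row col = 0 := by
  suffices h0 : wordRep n p (colAnti col) = 0 by
    rw [youngMat, youngSymm, map_mul, h0, zero_mul]
  ext a b
  choose c hc hc' using fun i : Fin (p + 1) => h.lower k i (col k) (by lia) le_rfl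
  obtain ⟨i, j, hij, hab⟩ := Fintype.exists_ne_map_eq_of_card_lt (fun i => a (c i)) (by simp)
  have hne : c i ≠ c j := fun he => hij (Fin.ext (by rw [← hc i, ← hc j, he]))
  have h1 := congrArg (wordRep n p)
    (single_mul_colAnti (swap_mem_fiberPerms ((hc' i).trans (hc' j).symm)))
  rw [Perm.sign_swap hne, map_mul, wordRep_single_one] at h1
  have h2 := congrFun (congrFun h1 a) b
  have h3 : a ∘ swap (c i) (c j) = a := by
    funext x
    rw [Function.comp_apply, swap_apply_def]
    split_ifs with hx hx
    · rw [hx, hab]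
    · rw [hx, hab]
    · rfl
  rw [permMat_mul_apply, h3] at h2
  exact eq_zero_of_eq_neg (by simpa using h2)

end Straightening

section Shapes

open Equiv

variable {p : ℕ}

/-- The sum of the first `m` entries of `lam`. -/
def partialSum (lam : Fin p → ℕ) (m : ℕ) : ℕ :=
  ∑ j ∈ Finset.univ.filter (fun j : Fin p => (j : ℕ) < m), lam j

lemma partialSum_zero (lam : Fin p → ℕ) : partialSum lam 0 = 0 := by simp [partialSum]

lemma partialSum_succ (lam : Fin p → ℕ) (m : ℕ) :
    partialSum lam (m + 1) = partialSum lam m + if h : m < p then lam ⟨m, h⟩ else 0 := by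
  simp only [partialSum, Finset.sum_filter]
  split_ifs with h
  · rw [← Finset.sum_ite_eq' Finset.univ (⟨m, h⟩ : Fin p) lam |>.trans (if_pos (Finset.mem_univ _)),
      ← Finset.sum_add_distrib]
    refine Finset.sum_congr rfl fun j _ => ?_
    simp only [Fin.ext_iff]
    split_ifs <;> lia
  · rw [add_zero]
    refine Finset.sum_congr rfl fun j _ => ?_
    have := j.2
    split_ifs <;> lia

lemma monotone_partialSum (lam : Fin p → ℕ) : Monotone (partialSum lam) :=
  monotone_nat_of_le_succ fun m => by
    rw [partialSum_succ]
    exact Nat.le_add_right _ _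

lemma partialSum_eq_sum (lam : Fin p → ℕ) {m : ℕ} (hm : p ≤ m) :
    partialSum lam m = ∑ i, lam i := by
  rw [partialSum, Finset.filter_true_of_mem]
  intro j _
  exact j.2.trans_le hm

lemma partialSum_le_sum (lam : Fin p → ℕ) (m : ℕ) : partialSum lam m ≤ ∑ i, lam i := by
  rw [← partialSum_eq_sum lam (le_max_left p m)]
  exact monotone_partialSum lam (le_max_right p m)

lemma rowOf_lt_iff (lam : Fin p → ℕ) {k : ℕ} (hk : k < ∑ i, lam i) (m : ℕ) :
    rowOf p lam k < m ↔ k < partialSum lam m := by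
  have hS : ∀ i : Fin p, ∑ j ∈ Finset.univ.filter (· ≤ i), lam j = partialSum lam (i + 1) := by
    intro i
    rw [partialSum]
    refine Finset.sum_congr (Finset.filter_congr fun j _ => ?_) fun _ _ => rfl
    rw [Nat.lt_succ_iff, Fin.le_def]
  have hrow : rowOf p lam k = ((Finset.range p).filter fun i => partialSum lam (i + 1) ≤ k).card := by
    rw [rowOf]
    simp only [hS, Finset.card_filter]
    exact Fin.sum_univ_eq_sum_range (fun i => if partialSum lam (i + 1) ≤ k then 1 else 0) p
  rw [hrow]
  constructor
  · intro h
    by_contra! hle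
    rcases le_or_gt m p with hm | hm
    · have : Finset.range m ⊆ (Finset.range p).filter fun i => partialSum lam (i + 1) ≤ k := by
        intro i hi
        rw [Finset.mem_range] at hi
        rw [Finset.mem_filter, Finset.mem_range]
        exact ⟨by lia, (monotone_partialSum lam hi).trans hle⟩
      have := Finset.card_le_card this
      rw [Finset.card_range] at this
      lia
    · rw [partialSum_eq_sum lam hm.le] at hle
      lia
  · intro h
    obtain ⟨m, rfl⟩ : ∃ m', m = m' + 1 := by
      cases m with
      | zero => simp [partialSum_zero] at h
      | succ m => exact ⟨m, rfl⟩
    have : (Finset.range p).filter (fun i => partialSum lam (i + 1) ≤ k) ⊆ Finset.range m := by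
      intro i hi
      rw [Finset.mem_filter] at hi
      rw [Finset.mem_range]
      by_contra! hle
      have := monotone_partialSum lam (Nat.succ_le_succ hle)
      lia
    have := Finset.card_le_card this
    rw [Finset.card_range] at this
    lia

lemma partialSum_rowOf_le (lam : Fin p → ℕ) {k : ℕ} (hk : k < ∑ i, lam i) :
    partialSum lam (rowOf p lam k) ≤ k := by
  by_contra! h
  exact lt_irrefl _ ((rowOf_lt_iff lam hk _).2 h)

lemma colOf_eq (lam : Fin p → ℕ) (k : ℕ) :
    colOf p lam k = k - partialSum lam (rowOf p lam k) := rfl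

lemma rowOf_eq_iff (lam : Fin p → ℕ) {k : ℕ} (hk : k < ∑ i, lam i) (m : ℕ) :
    rowOf p lam k = m ↔ partialSum lam m ≤ k ∧ k < partialSum lam (m + 1) := by
  rw [← rowOf_lt_iff lam hk, ← not_lt, ← rowOf_lt_iff lam hk]
  lia

lemma rowOf_eq_of_partialSum_eq {q : ℕ} {lam : Fin p → ℕ} {mu : Fin q → ℕ}
    (h : partialSum lam = partialSum mu) {k : ℕ} (hk : k < ∑ i, lam i) :
    rowOf p lam k = rowOf q mu k := by
  have hk' : k < ∑ i, mu i := by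
    rwa [← partialSum_eq_sum mu (le_max_right p q), ← h, partialSum_eq_sum lam (le_max_left p q)]
  rw [rowOf_eq_iff lam hk, h, ← rowOf_eq_iff mu hk']

lemma colOf_eq_of_partialSum_eq {q : ℕ} {lam : Fin p → ℕ} {mu : Fin q → ℕ}
    (h : partialSum lam = partialSum mu) {k : ℕ} (hk : k < ∑ i, lam i) :
    colOf p lam k = colOf q mu k := by
  rw [colOf_eq, colOf_eq, rowOf_eq_of_partialSum_eq h hk, h]

variable {n : ℕ}

/-- The row of each box of a diagram with `n` boxes. -/
abbrev boxRow (n : ℕ) {p : ℕ} (lam : Fin p → ℕ) : Fin n → ℕ := fun k => rowOf p lam k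

/-- The column of each box of a diagram with `n` boxes. -/
abbrev boxCol (n : ℕ) {p : ℕ} (lam : Fin p → ℕ) : Fin n → ℕ := fun k => colOf p lam k

lemma PartIdx.isRowMajor (lam : PartIdx n p) : IsRowMajor (boxRow n lam.1) (boxCol n lam.1) := by
  obtain ⟨lam, hanti, hsum⟩ := lam
  have hlt : ∀ k : Fin n, (k : ℕ) < ∑ i, lam i := fun k => hsum ▸ k.2
  have hle : ∀ k : Fin n, partialSum lam (rowOf p lam k) ≤ k := fun k =>
    partialSum_rowOf_le lam (hlt k)
  refine ⟨⟨fun k k' hr hc => ?_, fun k i j hi hj => ?_⟩, fun k k' hk => ?_, fun k k' hr hk => ?_⟩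
  · have h1 := hle k
    have h2 := hle k'
    simp only [colOf_eq] at hc
    change rowOf p lam k = rowOf p lam k' at hr
    rw [hr] at hc h1
    exact Fin.ext (by lia)
  · have h1 := hle k
    have h2 := ((rowOf_eq_iff lam (hlt k) _).1 rfl).2
    have h3 : j < if h : i < p then lam ⟨i, h⟩ else 0 := by
      rw [partialSum_succ] at h2
      simp only [colOf_eq] at hj
      split_ifs at h2 with h4
      · rw [dif_pos (lt_of_le_of_lt hi h4)]
        have := hanti ⟨i, lt_of_le_of_lt hi h4⟩ ⟨_, h4⟩ hi
        lia
      · lia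
    have h4 := partialSum_succ lam i
    have h5 := partialSum_le_sum lam (i + 1)
    have h6 : rowOf p lam (partialSum lam i + j) = i :=
      (rowOf_eq_iff lam (by lia) i).2 (by lia)
    refine ⟨⟨partialSum lam i + j, by lia⟩, h6, ?_⟩
    simp only [colOf_eq]
    rw [h6]
    lia
  · have h1 := ((rowOf_eq_iff lam (hlt k') _).1 rfl).2
    have hk' : (k : ℕ) ≤ k' := hk
    exact Nat.lt_succ_iff.1 ((rowOf_lt_iff lam (hlt k) _).2 (by lia))
  · have h1 := hle k
    have hk' : (k : ℕ) < k' := hk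
    simp only [colOf_eq, ← hr]
    lia

lemma boxesBelow_boxRow (lam : PartIdx n p) : boxesBelow (boxRow n lam.1) = partialSum lam.1 := by
  funext m
  have hlt : ∀ k : Fin n, (k : ℕ) < ∑ i, lam.1 i := fun k => by
    rw [lam.2.2]
    exact k.2
  have hle := partialSum_le_sum lam.1 m
  rw [lam.2.2] at hle
  rw [boxesBelow]
  simp only [rowOf_lt_iff lam.1 (hlt _)]
  refine Eq.trans ?_ (Fin.card_filter_val_lt.trans (min_eq_right hle))
  congr

lemma partialSum_injective : Function.Injective (partialSum : (Fin p → ℕ) → ℕ → ℕ) := by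
  intro lam mu h
  funext i
  have h1 := partialSum_succ lam i
  have h2 := partialSum_succ mu i
  simp only [h, Fin.is_lt, dif_pos, Fin.eta] at h1 h2
  lia

end Shapes

section Partitions

open Equiv

variable {n p : ℕ}

lemma sum_countP_lt (q : ℕ) (s : Multiset ℕ) (hs : ∀ x ∈ s, x ≤ q) :
    ∑ i : Fin q, s.countP (fun x => (i : ℕ) < x) = s.sum := by
  induction s using Multiset.induction with
  | empty => simp
  | cons a s ih =>
    simp only [Multiset.countP_cons, Finset.sum_add_distrib, Multiset.sum_cons]
    rw [ih fun x hx => hs x (Multiset.mem_cons_of_mem hx), add_comm]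
    congr 1
    rw [Fin.sum_univ_eq_sum_range (fun i => if i < a then 1 else 0) q, ← Finset.card_filter]
    conv_rhs => rw [← Finset.card_range a]
    congr 1
    ext i
    have := hs a (Multiset.mem_cons_self a s)
    simp only [Finset.mem_filter, Finset.mem_range]
    lia

lemma countP_lt_eq (s : Multiset ℕ) (i : ℕ) :
    s.countP (fun x => i < x) = s.countP (fun x => i + 1 < x) + s.count (i + 1) := by
  induction s using Multiset.induction with
  | empty => simp
  | cons a s ih =>
    simp only [Multiset.countP_cons, Multiset.count_cons, ih]
    split_ifs <;> lia

/-- The conjugate of a partition, as a partition into at most `q` parts. -/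
def conjPart {m q : ℕ} (hm : m = n) (hq : n ≤ q) (P : m.Partition) : PartIdx n q :=
  ⟨fun i => P.parts.countP fun x => (i : ℕ) < x,
    fun i j hij => by
      simp only [Multiset.countP_eq_card_filter]
      exact Multiset.card_le_card (Multiset.monotone_filter_right P.parts fun x hx =>
        lt_of_le_of_lt (show (i : ℕ) ≤ j from hij) hx),
    by rw [sum_countP_lt q _ fun x hx => (P.le_of_mem_parts hx).trans (hm.trans_le hq),
      P.parts_sum, hm]⟩

lemma conjPart_injective {m q : ℕ} (hm : m = n) (hq : n ≤ q) :
    Function.Injective (conjPart hm hq) := by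
  intro P Q h
  have h1 : ∀ i, P.parts.countP (fun x => i < x) = Q.parts.countP fun x => i < x := by
    intro i
    rcases lt_or_ge i q with hi | hi
    · exact congrFun (congrArg Subtype.val h) ⟨i, hi⟩
    · rw [Multiset.countP_eq_zero.2, Multiset.countP_eq_zero.2]
      · intro x hx
        have := Q.le_of_mem_parts hx
        lia
      · intro x hx
        have := P.le_of_mem_parts hx
        lia
  refine Nat.Partition.ext (Multiset.ext.2 fun x => ?_)
  cases x with
  | zero =>
    rw [Multiset.count_eq_zero_of_notMem fun h0 => lt_irrefl _ (P.parts_pos h0),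
      Multiset.count_eq_zero_of_notMem fun h0 => lt_irrefl _ (Q.parts_pos h0)]
  | succ i =>
    have h2 := countP_lt_eq P.parts i
    have h3 := countP_lt_eq Q.parts i
    rw [h1, h1 (i + 1)] at h2
    lia

lemma partialSum_castLE {q : ℕ} (h : p ≤ q) (mu : Fin q → ℕ) {m : ℕ} (hm : m ≤ p) :
    partialSum (fun i => mu (Fin.castLE h i)) m = partialSum mu m := by
  induction m with
  | zero => rw [partialSum_zero, partialSum_zero]
  | succ m ih =>
    rw [partialSum_succ, partialSum_succ, ih (by lia), dif_pos (by lia), dif_pos (by lia)]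
    rfl

lemma exists_partIdx_of_rowOf_lt {q : ℕ} (h : p ≤ q) (mu : PartIdx n q)
    (hrow : ∀ k : Fin n, rowOf q mu.1 k < p) :
    ∃ lam : PartIdx n p, boxRow n lam.1 = boxRow n mu.1 ∧ boxCol n lam.1 = boxCol n mu.1 := by
  have hp : partialSum mu.1 p = n := by
    rw [← boxesBelow_boxRow, boxesBelow, Finset.filter_true_of_mem fun k _ => hrow k,
      Finset.card_univ, Fintype.card_fin]
  have hsum : ∑ i : Fin p, mu.1 (Fin.castLE h i) = n := by
    rw [← partialSum_eq_sum _ le_rfl, partialSum_castLE h mu.1 le_rfl, hp]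
  have hS : partialSum (fun i => mu.1 (Fin.castLE h i)) = partialSum mu.1 := by
    funext m
    rcases le_or_gt m p with hm | hm
    · exact partialSum_castLE h mu.1 hm
    · rw [partialSum_eq_sum _ hm.le, hsum]
      refine le_antisymm ?_ ?_
      · exact hp.symm.trans_le (monotone_partialSum _ hm.le)
      · exact (partialSum_le_sum _ _).trans_eq mu.2.2
  have hlt : ∀ k : Fin n, (k : ℕ) < ∑ i : Fin p, mu.1 (Fin.castLE h i) := fun k => by
    rw [hsum]
    exact k.2
  exact ⟨⟨fun i => mu.1 (Fin.castLE h i), fun i j hij => mu.2.1 _ _ hij, hsum⟩,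
    funext fun k => rowOf_eq_of_partialSum_eq hS (hlt k),
    funext fun k => colOf_eq_of_partialSum_eq hS (hlt k)⟩

/-- The image of the Young symmetrizer of a partition in the matrices indexed by words. -/
abbrev PartIdx.youngMat (lam : PartIdx n p) : Matrix (Fin n → Fin p) (Fin n → Fin p) ℂ :=
  _root_.youngMat p (boxRow n lam.1) (boxCol n lam.1)

lemma eq_zero_of_mul_youngMat_eq_zero {M : Matrix (Fin n → Fin p) (Fin n → Fin p) ℂ}
    (hM : M ∈ invAlg n p) (h : ∀ lam : PartIdx n p, M * lam.youngMat = 0) : M = 0 := by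
  have hq : n ≤ n + p := Nat.le_add_right n p
  let mu := conjPart (Fintype.card_fin n) hq
  have hmu : ∀ P, M * _root_.youngMat p (boxRow n (mu P).1) (boxCol n (mu P).1) = 0 := by
    intro P
    by_cases hrow : ∀ k : Fin n, rowOf (n + p) (mu P).1 k < p
    · obtain ⟨lam, h1, h2⟩ := exists_partIdx_of_rowOf_lt (Nat.le_add_left p n) (mu P) hrow
      rw [← h1, ← h2]
      exact h lam
    · push Not at hrow
      obtain ⟨k, hk⟩ := hrow
      rw [youngMat_eq_zero (mu P).isRowMajor.toIsDiagram hk, mul_zero]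
  have hone := one_mem_span_conjSum (fun σ : Perm (Fin n) => σ.partition)
    (fun σ τ hστ => Perm.partition_eq_of_isConj.2 hστ)
    (fun P => youngSymm (boxRow n (mu P).1) (boxCol n (mu P).1))
    (fun P => coeff_one_youngSymm (mu P).isRowMajor.toIsDiagram)
    (fun P => youngSymm_mul_mul_youngSymm (mu P).isRowMajor.toIsDiagram)
    (fun P Q hPQ => youngSymm_mul_mul_youngSymm_of_ne (mu P).isRowMajor.toIsDiagram
      (mu Q).isRowMajor.toIsDiagram (by
        rw [boxesBelow_boxRow, boxesBelow_boxRow]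
        exact fun he => hPQ (conjPart_injective _ hq (Subtype.ext (partialSum_injective he)))))
  obtain ⟨a, ha⟩ := (Submodule.mem_span_range_iff_exists_fun ℂ).1 hone
  have h1 : M * wordRep n p 1 = M := by rw [map_one, mul_one]
  rw [← h1, ← ha, map_sum, Finset.mul_sum]
  refine Finset.sum_eq_zero fun P _ => ?_
  rw [map_smul, mul_smul_comm, conjSum, map_sum, Finset.mul_sum]
  refine smul_eq_zero_of_right _ (Finset.sum_eq_zero fun g _ => ?_)
  rw [map_mul, map_mul, ← mul_assoc, ← mul_assoc, ← wordRep_mul_comm hM, mul_assoc (wordRep n p _) M]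
  have h2 := hmu P
  rw [_root_.youngMat] at h2
  rw [h2, mul_zero, zero_mul]

end Partitions

section TableauVectors

open Equiv

variable {n p : ℕ}

lemma eT_apply (lam : Fin p → ℕ) (t a : Fin n → Fin p) :
    eT n p lam t a = ∑ σ ∈ fiberPerms (boxCol n lam), ((Perm.sign σ : ℤ) : ℂ) *
      if ∃ π ∈ fiberPerms (boxRow n lam), a ∘ σ = t ∘ ⇑π⁻¹ then 1 else 0 := by
  rw [eT, Finset.sum_apply]
  refine Finset.sum_congr rfl fun σ _ => ?_
  rw [Pi.smul_apply, smul_eq_mul, Finset.sum_apply]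
  congr 1
  have h : ∀ t' : Fin n → Fin p,
      (Pi.single (fun k => t' (σ⁻¹ k)) (1 : ℂ) : (Fin n → Fin p) → ℂ) a =
        if a ∘ σ = t' then 1 else 0 := by
    intro t'
    rw [Pi.single_apply]
    exact if_congr (comp_perm_eq_iff σ a t').symm rfl rfl
  simp only [h]
  rw [Finset.sum_ite_eq]
  refine if_congr ?_ rfl rfl
  rw [Finset.mem_filter]
  exact ⟨fun h => h.2, fun h => ⟨Finset.mem_univ _, h⟩⟩

lemma star_eT (lam : Fin p → ℕ) (t a : Fin n → Fin p) :
    star (eT n p lam t a) = eT n p lam t a := by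
  simp only [eT_apply, star_sum, star_mul', apply_ite star, star_one, star_zero, star_intCast]

lemma exists_youngMat_eq_mul_eT (lam : Fin p → ℕ) (t : Fin n → Fin p) :
    ∃ c : ℂ, c ≠ 0 ∧
      ∀ a, youngMat p (boxRow n lam) (boxCol n lam) a t = c * eT n p lam t a := by
  refine ⟨((fiberPerms (boxRow n lam)).filter fun π : Perm (Fin n) =>
    t ∘ ⇑π⁻¹ = t).card, ?_, fun a => ?_⟩
  · rw [Nat.cast_ne_zero]
    exact (Finset.card_pos.2 ⟨1, Finset.mem_filter.2 ⟨mem_fiberPerms.2 fun _ => rfl, by simp⟩⟩).ne'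
  rw [youngMat_apply, eT_apply, Finset.mul_sum]
  refine Finset.sum_congr rfl fun σ _ => ?_
  simp only [comp_perm_eq_iff _ (a ∘ σ)]
  split_ifs with h
  · obtain ⟨π₀, hπ₀, h⟩ := h
    rw [mul_one, ← sum_fiberPerms_mul_left hπ₀, h, ← Finset.sum_filter, Finset.sum_const,
      nsmul_eq_mul]
    congr 3
    refine Finset.filter_congr fun π _ => ?_
    rw [_root_.mul_inv_rev, Perm.coe_mul, ← Function.comp_assoc]
    constructor
    · intro h1
      exact ((Equiv.surjective π₀⁻¹).injective_comp_right h1).symm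
    · intro h1
      rw [h1]
  · rw [mul_zero, mul_zero]
    refine Finset.sum_eq_zero fun π hπ => if_neg fun h1 => h ⟨π, hπ, h1⟩

/-- The matrix with columns `e_t` for `t` semistandard. -/
def PartIdx.tabMat (lam : PartIdx n p) : Matrix (Fin n → Fin p) (SSYT n p lam.1) ℂ :=
  Matrix.of fun a t => eT n p lam.1 t.1 a

lemma PartIdx.conjTranspose_tabMat (lam : PartIdx n p) : lam.tabMatᴴ = lam.tabMatᵀ := by
  ext t a
  exact star_eT lam.1 t.1 a

lemma PartIdx.exists_tabMat_eq_youngMat_mul (lam : PartIdx n p) :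
    ∃ F : Matrix (Fin n → Fin p) (SSYT n p lam.1) ℂ, lam.tabMat = lam.youngMat * F := by
  choose c hc hY using exists_youngMat_eq_mul_eT (n := n) lam.1
  refine ⟨Matrix.of fun a t => if a = t.1 then (c t.1)⁻¹ else 0, ?_⟩
  ext a t
  simp only [Matrix.mul_apply, Matrix.of_apply, mul_ite, mul_zero, Finset.sum_ite_eq',
    Finset.mem_univ, if_true, hY, PartIdx.tabMat]
  field_simp [hc t.1]

lemma PartIdx.exists_youngMat_eq_tabMat_mul (lam : PartIdx n p) :
    ∃ Z : Matrix (SSYT n p lam.1) (Fin n → Fin p) ℂ, lam.youngMat = lam.tabMat * Z := by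
  choose c hc hY using exists_youngMat_eq_mul_eT (n := n) lam.1
  choose z hz using fun t => (Submodule.mem_span_range_iff_exists_fun ℂ
    (v := fun (s : SSYT n p lam.1) a => _root_.youngMat p (boxRow n lam.1) (boxCol n lam.1) a s.1)).1
    (youngMat_mem_span lam.isRowMajor (p := p) t)
  refine ⟨Matrix.of fun s t => c s.1 * z t s, ?_⟩
  ext a t
  change _root_.youngMat p (boxRow n lam.1) (boxCol n lam.1) a t = _
  rw [← congrFun (hz t) a]
  simp only [Finset.sum_apply, Pi.smul_apply, smul_eq_mul, Matrix.mul_apply, Matrix.of_apply, hY,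
    PartIdx.tabMat]
  exact Finset.sum_congr rfl fun s _ => by ring

lemma PartIdx.tabMat_mulVec_injective (lam : PartIdx n p) :
    Function.Injective lam.tabMat.mulVec := by
  choose c hc hY using exists_youngMat_eq_mul_eT (n := n) lam.1
  rw [Matrix.mulVec_injective_iff]
  have h : LinearIndependent ℂ fun (t : SSYT n p lam.1) a =>
      _root_.youngMat p (boxRow n lam.1) (boxCol n lam.1) a t.1 :=
    linearIndependent_youngMat lam.isRowMajor (p := p)
  suffices h' : lam.tabMat.col = (fun t : SSYT n p lam.1 => (Units.mk0 (c t.1) (hc t.1))⁻¹) •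
      fun t a => _root_.youngMat p (boxRow n lam.1) (boxCol n lam.1) a t.1 by
    rw [h']
    exact h.units_smul _
  funext t a
  change eT n p lam.1 t.1 a = (c t.1)⁻¹ * _root_.youngMat p (boxRow n lam.1) (boxCol n lam.1) a t.1
  rw [hY, inv_mul_cancel_left₀ (hc t.1)]

lemma blockMap_apply (M : Matrix (Fin n → Fin p) (Fin n → Fin p) ℂ) (lam : PartIdx n p) :
    blockMap n p M lam = lam.tabMatᴴ * M * lam.tabMat := by
  ext s t
  rw [Matrix.mul_assoc, Matrix.mul_apply]
  refine Finset.sum_congr rfl fun a _ => ?_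
  rw [mul_comm]
  rfl

end TableauVectors

section Orthonormalization

open scoped MatrixOrder

lemma exists_real_orthonormalizer {W T : Type*} [Fintype W] [Fintype T] [DecidableEq T]
    (E : Matrix W T ℂ) (hE : Eᴴ = Eᵀ) (hinj : Function.Injective E.mulVec) :
    ∃ R : Matrix T T ℂ, IsUnit R ∧ Rᴴ = Rᵀ ∧ Rᵀ * (Eᴴ * E) * R = 1 := by
  set E₀ : Matrix W T ℝ := E.map Complex.re with hE₀
  have hmap : E = E₀.map Complex.ofRealHom := by
    ext w t
    exact (Complex.conj_eq_iff_re.1 (congrFun (congrFun hE t) w)).symm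
  have hinj₀ : Function.Injective E₀.mulVec := by
    intro v w hvw
    have h : E *ᵥ (Complex.ofRealHom ∘ v) = E *ᵥ (Complex.ofRealHom ∘ w) := by
      funext i
      rw [hmap, ← RingHom.map_mulVec, ← RingHom.map_mulVec, hvw]
    funext i
    exact Complex.ofReal_injective (congrFun (hinj h) i)
  have hpos := Matrix.PosDef.conjTranspose_mul_self E₀ hinj₀
  obtain ⟨B, hB⟩ := CStarAlgebra.nonneg_iff_eq_star_mul_self.1 hpos.posSemidef.nonneg
  have hBu : IsUnit B.det := by
    have h := (Matrix.isUnit_iff_isUnit_det _).1 hpos.isUnit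
    rw [hB, Matrix.det_mul] at h
    exact isUnit_of_mul_isUnit_right h
  have h₀ : (B⁻¹)ᵀ * (E₀ᵀ * E₀) * B⁻¹ = 1 := by
    have h : E₀ᵀ * E₀ = Bᵀ * B := by
      simpa only [Matrix.conjTranspose_eq_transpose_of_trivial, Matrix.star_eq_conjTranspose] using hB
    rw [h, Matrix.mul_assoc, Matrix.mul_assoc, Matrix.mul_nonsing_inv B hBu, mul_one,
      ← Matrix.transpose_mul, Matrix.mul_nonsing_inv B hBu, Matrix.transpose_one]
  refine ⟨(B⁻¹).map Complex.ofRealHom, ?_, ?_, ?_⟩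
  · exact ((Matrix.isUnit_nonsing_inv_iff).2 ((Matrix.isUnit_iff_isUnit_det _).2 hBu)).map
      (Complex.ofRealHom.mapMatrix)
  · ext i j
    exact Complex.conj_ofReal _
  · have h₁ := congrArg (fun A : Matrix T T ℝ => A.map Complex.ofRealHom) h₀
    simp only [Matrix.map_mul, Matrix.map_one _ (map_zero _) (map_one _)]
      at h₁
    rw [hE, hmap]
    exact h₁

end Orthonormalization

section Blocks

open Equiv

variable {n p : ℕ}

instance PartIdx.instFinite : Finite (PartIdx n p) := by
  refine Finite.of_injective (β := Fin p → Fin (n + 1))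
    (fun lam i => ⟨lam.1 i, Nat.lt_succ_of_le ?_⟩) fun lam mu h => Subtype.ext (funext fun i => ?_)
  · exact (Finset.single_le_sum (f := lam.1) (fun _ _ => Nat.zero_le _)
      (Finset.mem_univ i)).trans_eq lam.2.2
  · exact congrArg Fin.val (congrFun h i)

lemma conjTranspose_mem_invAlg {M : Matrix (Fin n → Fin p) (Fin n → Fin p) ℂ}
    (hM : M ∈ invAlg n p) : Mᴴ ∈ invAlg n p := fun σ a b => congrArg star (hM σ b a)

lemma mul_mem_invAlg {M N : Matrix (Fin n → Fin p) (Fin n → Fin p) ℂ}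
    (hM : M ∈ invAlg n p) (hN : N ∈ invAlg n p) : M * N ∈ invAlg n p := by
  rw [mem_invAlg_iff] at *
  intro g
  rw [← mul_assoc, hM, mul_assoc, hN, mul_assoc]

lemma sum_conj_mem_invAlg (P : Matrix (Fin n → Fin p) (Fin n → Fin p) ℂ) :
    ∑ g : Perm (Fin n), permMat p g * P * permMat p g⁻¹ ∈ invAlg n p := by
  rw [mem_invAlg_iff]
  have hmul : ∀ g h : Perm (Fin n), permMat p g * permMat p h = permMat p (g * h) :=
    fun g h => (map_mul (permMatHom n p) g h).symm
  intro h
  rw [Finset.mul_sum, Finset.sum_mul]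
  refine Fintype.sum_equiv (Equiv.mulLeft h) _ _ fun g => ?_
  rw [Equiv.coe_mulLeft, ← mul_assoc, ← mul_assoc, hmul, mul_assoc _ _ (permMat p h), hmul]
  congr 2
  group

namespace PartIdx

variable (lam : PartIdx n p)

lemma isUnit_gram : IsUnit (lam.tabMatᴴ * lam.tabMat) :=
  (Matrix.PosDef.conjTranspose_mul_self _ lam.tabMat_mulVec_injective).isUnit

lemma exists_mul_tabMat_eq_one :
    ∃ L : Matrix (SSYT n p lam.1) (Fin n → Fin p) ℂ, L * lam.tabMat = 1 := by
  refine ⟨(lam.tabMatᴴ * lam.tabMat)⁻¹ * lam.tabMatᴴ, ?_⟩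
  rw [Matrix.mul_assoc, Matrix.nonsing_inv_mul _ ((Matrix.isUnit_iff_isUnit_det _).1 lam.isUnit_gram)]

lemma exists_mul_tabMat_eq {M : Matrix (Fin n → Fin p) (Fin n → Fin p) ℂ} (hM : M ∈ invAlg n p) :
    ∃ X : Matrix (SSYT n p lam.1) (SSYT n p lam.1) ℂ, M * lam.tabMat = lam.tabMat * X := by
  obtain ⟨F, hF⟩ := lam.exists_tabMat_eq_youngMat_mul
  obtain ⟨Z, hZ⟩ := lam.exists_youngMat_eq_tabMat_mul
  refine ⟨Z * M * F, ?_⟩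
  calc M * lam.tabMat = M * lam.youngMat * F := by rw [Matrix.mul_assoc, ← hF]
    _ = lam.youngMat * M * F := congrArg (· * F) (wordRep_mul_comm hM _).symm
    _ = lam.tabMat * (Z * M * F) := by
      rw [hZ]
      simp only [Matrix.mul_assoc]

lemma exists_mem_invAlg_mul_tabMat_eq (X : Matrix (SSYT n p lam.1) (SSYT n p lam.1) ℂ) :
    ∃ M ∈ invAlg n p, M * lam.tabMat = lam.tabMat * X ∧
      ∀ mu : PartIdx n p, mu ≠ lam → M * mu.tabMat = 0 := by
  obtain ⟨F, hF⟩ := lam.exists_tabMat_eq_youngMat_mul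
  have hD := lam.isRowMajor.toIsDiagram
  set y := youngSymm (boxRow n lam.1) (boxCol n lam.1) with hy
  have hY : lam.youngMat = wordRep n p y := rfl
  have hone := coeff_one_youngSymm hD
  have hquasi := youngSymm_mul_mul_youngSymm hD
  rw [← hy] at hone hquasi
  set κ := (y * y).coeff 1 with hκ
  have hκ0 : κ ≠ 0 := MonoidAlgebra.coeff_mul_self_ne_zero hone hquasi
  have hyy : y * y = κ • y := MonoidAlgebra.mul_self_eq hone hquasi
  have hsum : ∑ g : Perm (Fin n), (y * y).coeff g⁻¹ • permMat p g⁻¹ = κ • lam.youngMat := by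
    rw [hY, ← map_smul, ← hyy]
    refine (Equiv.sum_comp (Equiv.inv (Perm (Fin n)))
      fun g => (y * y).coeff g • permMat p g).trans ?_
    conv_rhs => rw [MonoidAlgebra.eq_sum_coeff_smul (y * y)]
    simp only [map_sum, map_smul, wordRep_single_one]
  obtain ⟨L, hLE⟩ := lam.exists_mul_tabMat_eq_one
  set Q : Matrix (Fin n → Fin p) (Fin n → Fin p) ℂ := κ⁻¹ • (F * X * L) with hQ
  set M := ∑ g : Perm (Fin n), permMat p g * (lam.youngMat * Q) * permMat p g⁻¹ with hM
  have hMmem : M ∈ invAlg n p := sum_conj_mem_invAlg _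
  have hMY : M * lam.youngMat = lam.youngMat * (F * X * L) * lam.youngMat := by
    have h1 : ∀ g : Perm (Fin n), lam.youngMat * (permMat p g * (lam.youngMat * Q) * permMat p g⁻¹) =
        lam.youngMat * Q * ((y * y).coeff g⁻¹ • permMat p g⁻¹) := by
      intro g
      have h2 := congrArg (wordRep n p) (MonoidAlgebra.mul_single_mul_eq hone hquasi g)
      rw [map_mul, map_mul, map_smul, wordRep_single_one, ← hY] at h2
      rw [← mul_assoc, ← mul_assoc, ← mul_assoc, h2]
      simp only [smul_mul_assoc, mul_smul_comm]
    rw [hY, ← wordRep_mul_comm hMmem, ← hY, hM, Finset.mul_sum, Finset.sum_congr rfl fun g _ => h1 g,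
      ← Finset.mul_sum, hsum, hQ]
    simp only [smul_mul_assoc, mul_smul_comm, smul_smul, mul_inv_cancel₀ hκ0, one_smul]
  refine ⟨M, hMmem, ?_, fun mu hmu => ?_⟩
  · calc M * lam.tabMat = M * lam.youngMat * F := by rw [Matrix.mul_assoc, ← hF]
      _ = lam.youngMat * F * X * (L * (lam.youngMat * F)) := by
        rw [hMY]
        simp only [Matrix.mul_assoc]
      _ = lam.tabMat * X := by rw [← hF, hLE, Matrix.mul_one]
  · obtain ⟨F', hF'⟩ := mu.exists_tabMat_eq_youngMat_mul
    have h0 : M * mu.youngMat = 0 := by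
      refine (wordRep_mul_comm hMmem _).symm.trans ?_
      rw [hM, Finset.mul_sum]
      refine Finset.sum_eq_zero fun g _ => ?_
      have h2 := congrArg (wordRep n p) (youngSymm_mul_mul_youngSymm_of_ne
        mu.isRowMajor.toIsDiagram hD (fun he => hmu (Subtype.ext (partialSum_injective (by
          rwa [boxesBelow_boxRow, boxesBelow_boxRow] at he)))) (MonoidAlgebra.single g 1))
      rw [map_mul, map_mul, map_zero, wordRep_single_one, ← hy, ← hY] at h2
      rw [← mul_assoc, ← mul_assoc, ← mul_assoc, h2, zero_mul, zero_mul]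
    rw [hF', ← Matrix.mul_assoc, h0, Matrix.zero_mul]

end PartIdx

lemma exists_mem_invAlg_forall_mul_tabMat_eq
    (X : (lam : PartIdx n p) → Matrix (SSYT n p lam.1) (SSYT n p lam.1) ℂ) :
    ∃ M ∈ invAlg n p, ∀ lam : PartIdx n p, M * lam.tabMat = lam.tabMat * X lam := by
  have := Fintype.ofFinite (PartIdx n p)
  choose M hM h1 h2 using fun lam : PartIdx n p => lam.exists_mem_invAlg_mul_tabMat_eq (X lam)
  refine ⟨∑ lam, M lam, Submodule.sum_mem _ fun lam _ => hM lam, fun lam => ?_⟩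
  rw [Matrix.sum_mul, Finset.sum_eq_single lam, h1]
  · exact fun mu _ hne => h2 mu lam hne.symm
  · simp

lemma isLinearMap_blockMap : IsLinearMap ℂ (blockMap n p) where
  map_add M N := by
    funext lam
    simp only [Pi.add_apply, blockMap_apply, Matrix.mul_add, Matrix.add_mul]
  map_smul c M := by
    funext lam
    simp only [Pi.smul_apply, blockMap_apply, Matrix.mul_smul, Matrix.smul_mul]

lemma bijOn_blockMap : Set.BijOn (blockMap n p) (invAlg n p) Set.univ := by
  refine ⟨Set.mapsTo_univ _ _, fun M hM N hN h => ?_, fun B _ => ?_⟩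
  · rw [← sub_eq_zero]
    have hMN : M - N ∈ invAlg n p := Submodule.sub_mem _ hM hN
    refine eq_zero_of_mul_youngMat_eq_zero hMN fun lam => ?_
    obtain ⟨X, hX⟩ := lam.exists_mul_tabMat_eq hMN
    obtain ⟨Z, hZ⟩ := lam.exists_youngMat_eq_tabMat_mul
    have h0 : lam.tabMatᴴ * lam.tabMat * X = 0 := by
      rw [Matrix.mul_assoc, ← hX, ← Matrix.mul_assoc, ← blockMap_apply,
        isLinearMap_blockMap.map_sub, h, sub_self]
      rfl
    have hX0 : X = 0 := lam.isUnit_gram.mul_right_eq_zero.1 h0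
    rw [hZ, ← Matrix.mul_assoc, hX, hX0, Matrix.mul_zero, Matrix.zero_mul]
  · obtain ⟨M, hM, h⟩ := exists_mem_invAlg_forall_mul_tabMat_eq
      fun lam => (lam.tabMatᴴ * lam.tabMat)⁻¹ * B lam
    refine ⟨M, hM, funext fun lam => ?_⟩
    rw [blockMap_apply, Matrix.mul_assoc, h, ← Matrix.mul_assoc,
      Matrix.mul_nonsing_inv_cancel_left _ _ ((Matrix.isUnit_iff_isUnit_det _).1 lam.isUnit_gram)]

end Blocks

section NormalizedBlocks

variable {n p : ℕ}

lemma blockMap_one (lam : PartIdx n p) :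
    blockMap n p 1 lam = lam.tabMatᴴ * lam.tabMat := by
  rw [blockMap_apply, Matrix.mul_one]

lemma blockMap_conjTranspose (M : Matrix (Fin n → Fin p) (Fin n → Fin p) ℂ) (lam : PartIdx n p) :
    blockMap n p Mᴴ lam = (blockMap n p M lam)ᴴ := by
  simp only [blockMap_apply, Matrix.conjTranspose_mul, Matrix.conjTranspose_conjTranspose,
    Matrix.mul_assoc]

lemma normalized_blockMap_mul {lam : PartIdx n p}
    {R : Matrix (SSYT n p lam.1) (SSYT n p lam.1) ℂ} (hR : Rᵀ * blockMap n p 1 lam * R = 1)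
    (M : Matrix (Fin n → Fin p) (Fin n → Fin p) ℂ) {N : Matrix (Fin n → Fin p) (Fin n → Fin p) ℂ}
    (hN : N ∈ invAlg n p) :
    Rᵀ * blockMap n p (M * N) lam * R =
      Rᵀ * blockMap n p M lam * R * (Rᵀ * blockMap n p N lam * R) := by
  obtain ⟨X, hX⟩ := lam.exists_mul_tabMat_eq hN
  have hR' : R * (Rᵀ * blockMap n p 1 lam) = 1 := mul_eq_one_comm.1 hR
  have hMN : blockMap n p (M * N) lam = blockMap n p M lam * X := by
    simp only [blockMap_apply, Matrix.mul_assoc, hX]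
  have hN' : blockMap n p N lam = blockMap n p 1 lam * X := by
    simp only [blockMap_apply, Matrix.mul_assoc, hX, Matrix.one_mul]
  calc Rᵀ * blockMap n p (M * N) lam * R = Rᵀ * blockMap n p M lam * 1 * X * R := by
        rw [hMN, mul_one, ← mul_assoc]
    _ = Rᵀ * blockMap n p M lam * R * (Rᵀ * blockMap n p N lam * R) := by
        rw [← hR', hN']
        simp only [mul_assoc]

lemma bijOn_normalized_blockMap
    {R : (lam : PartIdx n p) → Matrix (SSYT n p lam.1) (SSYT n p lam.1) ℂ}
    (hR : ∀ lam, IsUnit (R lam)) :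
    Set.BijOn (fun M => fun lam => (R lam)ᵀ * blockMap n p M lam * R lam)
      (invAlg n p) Set.univ := by
  have hRdet := fun lam => (Matrix.isUnit_iff_isUnit_det _).1 (hR lam)
  have hRt : ∀ lam, IsUnit (R lam)ᵀ := fun lam => (Matrix.isUnit_transpose _).2 (hR lam)
  have hRtdet := fun lam => (Matrix.isUnit_iff_isUnit_det _).1 (hRt lam)
  refine ⟨Set.mapsTo_univ _ _, fun M hM N hN h => bijOn_blockMap.injOn hM hN ?_, fun B _ => ?_⟩
  · funext lam
    exact (hRt lam).mul_left_cancel ((hR lam).mul_right_cancel (congrFun h lam))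
  · obtain ⟨M, hM, h⟩ := bijOn_blockMap.surjOn
      (Set.mem_univ fun lam => (R lam)ᵀ⁻¹ * (B lam * (R lam)⁻¹))
    refine ⟨M, hM, funext fun lam => ?_⟩
    beta_reduce
    rw [h, Matrix.mul_nonsing_inv_cancel_left _ _ (hRtdet lam),
      Matrix.nonsing_inv_mul_cancel_right _ _ (hRdet lam)]

open scoped MatrixOrder in
lemma posSemidef_iff_forall_posSemidef_blockMap
    {R : (lam : PartIdx n p) → Matrix (SSYT n p lam.1) (SSYT n p lam.1) ℂ}
    (hreal : ∀ lam, (R lam)ᴴ = (R lam)ᵀ) (hR : ∀ lam, IsUnit (R lam))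
    (hone : ∀ lam, (R lam)ᵀ * blockMap n p 1 lam * R lam = 1)
    {M : Matrix (Fin n → Fin p) (Fin n → Fin p) ℂ} (hM : M ∈ invAlg n p) :
    M.PosSemidef ↔ ∀ lam, (blockMap n p M lam).PosSemidef := by
  refine ⟨fun h lam => ?_, fun h => ?_⟩
  · rw [blockMap_apply]
    exact h.conjTranspose_mul_mul_same _
  · choose B hB using fun lam => CStarAlgebra.nonneg_iff_eq_star_mul_self.1
      ((h lam).conjTranspose_mul_mul_same (R lam)).nonneg
    obtain ⟨N, hN, hNB⟩ := (bijOn_normalized_blockMap hR).surjOn (Set.mem_univ B)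
    have hMN : M = Nᴴ * N := by
      refine (bijOn_normalized_blockMap hR).injOn hM
        (mul_mem_invAlg (conjTranspose_mem_invAlg hN) hN) (funext fun lam => ?_)
      have hNB' : (R lam)ᵀ * blockMap n p N lam * R lam = B lam := congrFun hNB lam
      have hstar : (R lam)ᵀ * blockMap n p Nᴴ lam * R lam = (B lam)ᴴ := by
        rw [← hNB', blockMap_conjTranspose, ← hreal]
        simp only [Matrix.conjTranspose_mul, Matrix.conjTranspose_conjTranspose, mul_assoc]
      rw [normalized_blockMap_mul (hone lam) _ hN, hNB', hstar, ← hreal, hB,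
        Matrix.star_eq_conjTranspose]
    rw [hMN]
    exact Matrix.posSemidef_conjTranspose_mul_self N

end NormalizedBlocks

/-- there are invertible matrices `R_λ` such that
`ψ : M ↦ ⊕_λ R_λᵀ (⟨M e_s, e_t⟩)_{s,t} R_λ` is a bijective ℂ-algebra `∗`-homomorphism
from `𝒜` onto `⊕_λ ℂ^{SSYT(λ,p) × SSYT(λ,p)}`; moreover `ψ' : M ↦ ⊕_λ (⟨M e_s, e_t⟩)_{s,t}`
is a linear bijection from `𝒜` onto the same space, and `M ∈ 𝒜` is positive semidefinite
iff all its blocks are. -/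
theorem stmt_5 (n p : ℕ) (hn : 1 ≤ n) (hp : 1 ≤ p) :
    (∃ R : (lam : PartIdx n p) → Matrix (SSYT n p lam.1) (SSYT n p lam.1) ℂ,
      (∀ lam, IsUnit (R lam)) ∧
      IsLinearMap ℂ (fun M => fun lam => (R lam)ᵀ * blockMap n p M lam * R lam) ∧
      Set.BijOn (fun M => fun lam => (R lam)ᵀ * blockMap n p M lam * R lam)
        (invAlg n p) Set.univ ∧
      (fun lam => (R lam)ᵀ * blockMap n p (1 : Matrix _ _ ℂ) lam * R lam) = 1 ∧
      (∀ M₁ M₂, M₁ ∈ invAlg n p → M₂ ∈ invAlg n p →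
        (fun lam => (R lam)ᵀ * blockMap n p (M₁ * M₂) lam * R lam) =
          (fun lam => (R lam)ᵀ * blockMap n p M₁ lam * R lam) *
            (fun lam => (R lam)ᵀ * blockMap n p M₂ lam * R lam)) ∧
      (∀ M ∈ invAlg n p,
        (fun lam => (R lam)ᵀ * blockMap n p Mᴴ lam * R lam) =
          star (fun lam => (R lam)ᵀ * blockMap n p M lam * R lam))) ∧
    IsLinearMap ℂ (blockMap n p) ∧
    Set.BijOn (blockMap n p) (invAlg n p) Set.univ ∧
    (∀ M ∈ invAlg n p,
      (Matrix.PosSemidef M ↔ ∀ lam, Matrix.PosSemidef (blockMap n p M lam))) := by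
  choose R hR hreal hone using fun lam : PartIdx n p =>
    exists_real_orthonormalizer lam.tabMat lam.conjTranspose_tabMat lam.tabMat_mulVec_injective
  simp only [← blockMap_one] at hone
  refine ⟨⟨R, hR, ⟨fun M N => funext fun lam => ?_, fun c M => funext fun lam => ?_⟩,
    bijOn_normalized_blockMap hR, funext hone, fun M N _ hN => funext fun lam => ?_,
    fun M _ => funext fun lam => ?_⟩, isLinearMap_blockMap, bijOn_blockMap,
    fun M hM => posSemidef_iff_forall_posSemidef_blockMap hreal hR hone hM⟩
  · simp only [isLinearMap_blockMap.map_add, Pi.add_apply, mul_add, add_mul]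
  · simp only [isLinearMap_blockMap.map_smul, Pi.smul_apply, mul_smul_comm, smul_mul_assoc]
  · exact normalized_blockMap_mul (hone lam) M hN
  · rw [Pi.star_apply, Matrix.star_eq_conjTranspose, blockMap_conjTranspose, ← hreal]
    simp only [Matrix.conjTranspose_mul, Matrix.conjTranspose_conjTranspose, mul_assoc]
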